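/- arXiv:1507.07356 — 9 statements merged into one kernel-verified Lean document; each statement's English description precedes it below -/
import Mathlib

section
/- Let α ∈ (0, 2) and λ ≥ 0. Then λ^{α/2} = (1/|Γ(-α/2)|) · ∫_0^∞ (1 - e^{-tλ}) t^{-1-α/2} dt, where the integral is over t ∈ (0, ∞) and is absolutely convergent. -/
open MeasureTheory Real Filter Set Topology

lemma bern_aux (s l : ℝ) (hs0 : 0 < s) (hs1 : s < 1) (hl : 0 < l) :
    IntegrableOn (fun t : ℝ => (1 - Real.exp (-(t * l))) * t ^ (-1 - s)) (Set.Ioi 0) ∧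
    ∫ t in Set.Ioi (0:ℝ), (1 - Real.exp (-(t * l))) * t ^ (-1 - s)
      = l ^ s * (Real.Gamma (1 - s) / s) := by
  have hu0 : ∀ t : ℝ, 0 < t → 0 ≤ 1 - Real.exp (-(t * l)) := by
    intro t ht
    have : Real.exp (-(t * l)) ≤ 1 := Real.exp_le_one_iff.2 (by nlinarith [mul_pos ht hl])
    linarith
  have hu1 : ∀ t : ℝ, 1 - Real.exp (-(t * l)) ≤ 1 := fun t => by
    linarith [Real.exp_pos (-(t * l))]
  have hu2 : ∀ t : ℝ, 1 - Real.exp (-(t * l)) ≤ t * l := fun t => by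
    linarith [Real.add_one_le_exp (-(t * l))]
  have hmeas : Measurable (fun t : ℝ => (1 - Real.exp (-(t * l))) * t ^ (-1 - s)) := by
    fun_prop
  have hint : IntegrableOn (fun t : ℝ => (1 - Real.exp (-(t * l))) * t ^ (-1 - s)) (Set.Ioi 0) := by
    rw [← Set.Ioc_union_Ioi_eq_Ioi (zero_le_one (α := ℝ))]
    refine IntegrableOn.union ?_ ?_
    · have h1 : IntegrableOn (fun t : ℝ => l * t ^ (-s)) (Set.Ioc 0 1) := by
        have := (intervalIntegral.intervalIntegrable_rpow' (a := 0) (b := 1)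
          (show -1 < -s by linarith)).const_mul l
        exact (intervalIntegrable_iff_integrableOn_Ioc_of_le zero_le_one).1 this
      refine Integrable.mono' h1 hmeas.aestronglyMeasurable ?_
      refine (ae_restrict_iff' measurableSet_Ioc).2 (Eventually.of_forall fun t ht => ?_)
      have hp : 0 ≤ t ^ (-1 - s) := Real.rpow_nonneg ht.1.le _
      rw [Real.norm_of_nonneg (mul_nonneg (hu0 t ht.1) hp)]
      have e : t ^ (-s) = t * t ^ (-1 - s) := by
        rw [show -s = 1 + (-1 - s) by ring, Real.rpow_add ht.1, Real.rpow_one]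
      rw [e]
      calc _ ≤ (t * l) * t ^ (-1 - s) := mul_le_mul_of_nonneg_right (hu2 t) hp
        _ = _ := by ring
    · refine Integrable.mono' (integrableOn_Ioi_rpow_of_lt (show -1 - s < -1 by linarith) one_pos)
        hmeas.aestronglyMeasurable ?_
      refine (ae_restrict_iff' measurableSet_Ioi).2 (Eventually.of_forall fun t ht => ?_)
      have ht0 : 0 < t := lt_trans one_pos ht
      have hp : 0 ≤ t ^ (-1 - s) := Real.rpow_nonneg ht0.le _
      rw [Real.norm_of_nonneg (mul_nonneg (hu0 t ht0) hp)]
      exact mul_le_of_le_one_left hp (hu1 t)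
  refine ⟨hint, ?_⟩
  have hgi : IntegrableOn (fun t : ℝ => t ^ (-s) * Real.exp (-l * t)) (Set.Ioi 0) := by
    simpa using integrableOn_rpow_mul_exp_neg_mul_rpow (show -1 < -s by linarith) one_pos hl
  have hg : ∫ t in Set.Ioi (0:ℝ), t ^ (-s) * Real.exp (-l * t)
      = l ^ (s - 1) * Real.Gamma (1 - s) := by
    have := integral_rpow_mul_exp_neg_mul_rpow one_pos (show -1 < -s by linarith) hl
    simp only [Real.rpow_one, div_one, mul_one] at this
    rw [this]
    congr 2 <;> ring
  have hfe : (fun t : ℝ => (l * Real.exp (-(t * l))) * (-(1 / s) * t ^ (-s)))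
      = fun t => (-(l / s)) * (t ^ (-s) * Real.exp (-l * t)) := by
    funext t
    rw [show -(t * l) = -l * t by ring]
    ring
  have key := integral_Ioi_mul_deriv_eq_deriv_mul (a := (0:ℝ)) (a' := (0:ℝ)) (b' := (0:ℝ))
    (u := fun t : ℝ => 1 - Real.exp (-(t * l))) (v := fun t : ℝ => -(1 / s) * t ^ (-s))
    (u' := fun t : ℝ => l * Real.exp (-(t * l))) (v' := fun t : ℝ => t ^ (-1 - s))
    ?_ ?_ hint ?_ ?_ ?_
  · rw [key, hfe, integral_const_mul, hg, Real.rpow_sub_one hl.ne']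
    field_simp
    ring
  · intro t _
    have h := ((((hasDerivAt_id t).mul_const l).neg).exp).const_sub 1
    have e : l * Real.exp (-(t * l)) = -(Real.exp (-(t * l)) * -(1 * l)) := by ring
    rw [e]
    exact h
  · intro t ht
    have h := (Real.hasDerivAt_rpow_const (x := t) (p := -s) (Or.inl (ne_of_gt ht))).const_mul
      (-(1 / s))
    convert h using 1
    rw [show -s - 1 = -1 - s by ring]
    field_simp
  · have : IntegrableOn (fun t : ℝ => (l * Real.exp (-(t * l))) * (-(1 / s) * t ^ (-s)))
        (Set.Ioi 0) := by
      rw [hfe]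
      exact hgi.const_mul _
    exact this
  · have hlim : Tendsto (fun t : ℝ => (l / s) * t ^ (1 - s)) (𝓝[>] 0) (𝓝 0) := by
      have h : ContinuousAt (fun t : ℝ => (l / s) * t ^ (1 - s)) 0 :=
        (Real.continuousAt_rpow_const 0 (1 - s) (Or.inr (by linarith))).const_mul _
      have h2 := h.tendsto
      rw [Real.zero_rpow (by linarith), mul_zero] at h2
      exact h2.mono_left nhdsWithin_le_nhds
    refine squeeze_zero_norm' ?_ hlim
    filter_upwards [self_mem_nhdsWithin] with t ht
    have ht : 0 < t := ht
    have hp : 0 ≤ t ^ (-s) := Real.rpow_nonneg ht.le _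
    have e : t ^ (1 - s) = t * t ^ (-s) := by
      rw [show 1 - s = 1 + (-s) by ring, Real.rpow_add ht, Real.rpow_one]
    simp only [Pi.mul_apply, norm_mul, norm_neg]
    rw [Real.norm_of_nonneg (hu0 t ht), Real.norm_of_nonneg hp,
      Real.norm_of_nonneg (by positivity : 0 ≤ 1 / s), e]
    calc _ ≤ (t * l) * (1 / s * t ^ (-s)) :=
          mul_le_mul_of_nonneg_right (hu2 t) (by positivity)
      _ = _ := by ring
  · have hlim : Tendsto (fun t : ℝ => (1 / s) * t ^ (-s)) atTop (𝓝 0) := by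
      simpa using (tendsto_rpow_neg_atTop hs0).const_mul (1 / s)
    refine squeeze_zero_norm' ?_ hlim
    filter_upwards [eventually_gt_atTop 0] with t ht
    have hp : 0 ≤ t ^ (-s) := Real.rpow_nonneg ht.le _
    simp only [Pi.mul_apply, norm_mul, norm_neg]
    rw [Real.norm_of_nonneg (hu0 t ht), Real.norm_of_nonneg hp,
      Real.norm_of_nonneg (by positivity : 0 ≤ 1 / s)]
    exact mul_le_of_le_one_left (by positivity) (hu1 t)

/-- Bernstein-function representation of `λ^(α/2)`:
for `α ∈ (0,2)` and `λ ≥ 0`,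
`λ^(α/2) = (1/|Γ(-α/2)|) ∫_0^∞ (1 - e^{-tλ}) t^{-1-α/2} dt`,
the integral being absolutely convergent. -/
theorem bernstein_rep_rpow (α lam : ℝ) (hα : α ∈ Set.Ioo (0:ℝ) 2) (hlam : 0 ≤ lam) :
    IntegrableOn (fun t : ℝ => (1 - Real.exp (-(t * lam))) * t ^ (-1 - α / 2)) (Set.Ioi 0) ∧
    lam ^ (α / 2) =
      (1 / |Real.Gamma (-(α / 2))|) *
        ∫ t in Set.Ioi (0:ℝ), (1 - Real.exp (-(t * lam))) * t ^ (-1 - α / 2) := by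
  obtain ⟨h0, h2⟩ := hα
  rcases hlam.eq_or_lt with rfl | hl
  · have : α / 2 ≠ 0 := by positivity
    simp [Real.zero_rpow this]
  · obtain ⟨hi, he⟩ := bern_aux (α / 2) lam (by linarith) (by linarith) hl
    refine ⟨hi, ?_⟩
    rw [he]
    have hs : 0 < α / 2 := by linarith
    generalize hS : α / 2 = s at *
    have hG : Real.Gamma (1 - s) = -s * Real.Gamma (-s) := by
      rw [← Real.Gamma_add_one (by linarith : -s < 0).ne]
      congr 1
      ring
    have hpos : 0 < Real.Gamma (1 - s) := Real.Gamma_pos_of_pos (by linarith)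
    have hA : Real.Gamma (1 - s) / s = |Real.Gamma (-s)| := by
      have hneg : Real.Gamma (-s) < 0 := by
        by_contra hc
        push Not at hc
        nlinarith [mul_nonneg hs.le hc]
      rw [abs_of_neg hneg, hG]
      field_simp
    have hne : |Real.Gamma (-s)| ≠ 0 := by
      rw [← hA]
      positivity
    rw [hA]
    field_simp
end

section
/- Let d ≥ 1 be an integer, α ∈ (0, 2), R > 0, and z ∈ ℝ^d with |z| > R. Then c_{d,α}|z|^{-d-α} = (4R^{2−α}/(α Γ(α/2)|Γ(-α/2)|)) · ∫_R^{|z|} c_{d,α} |z|^{-d} (|z|² − r²)^{-α/2} · r^{-1}(r² − R²)^{α/2 − 1} dr, where c_{d,α} = 2^α Γ((d+α)/2)/(π^{d/2}|Γ(-α/2)|), and the integral is absolutely convergent. -/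
open MeasureTheory Real Filter Set Topology

/-- The real Beta integrand on `(0,1)`: integrability. -/
lemma aux_beta_integrable (a : ℝ) (h0 : 0 < a) (h1 : a < 1) :
    IntegrableOn (fun u : ℝ => u ^ (a - 1) * (1 - u) ^ (-a)) (Set.Ioo 0 1) := by
  have h := Complex.betaIntegral_convergent (u := (a : ℂ)) (v := ((1 - a : ℝ) : ℂ))
    (by simpa using h0) (by simpa using h1)
  rw [intervalIntegrable_iff_integrableOn_Ioo_of_le zero_le_one] at h
  have h2 := h.norm
  refine (integrableOn_congr_fun ?_ measurableSet_Ioo).1 h2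
  intro x hx
  have hx1 : (0:ℝ) < 1 - x := by linarith [hx.2]
  have e : (1 - (x:ℂ)) = ((1 - x : ℝ) : ℂ) := by push_cast; ring
  simp only [norm_mul]
  rw [e, Complex.norm_cpow_eq_rpow_re_of_pos hx.1, Complex.norm_cpow_eq_rpow_re_of_pos hx1]
  simp

/-- The real Beta integral `B(a, 1-a)`. -/
lemma aux_beta_integral (a : ℝ) (h0 : 0 < a) (h1 : a < 1) :
    ∫ u in Set.Ioo (0:ℝ) 1, u ^ (a - 1) * (1 - u) ^ (-a)
      = Real.Gamma a * Real.Gamma (1 - a) := by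
  have h := Complex.Gamma_mul_Gamma_eq_betaIntegral (s := (a : ℂ)) (t := ((1 - a : ℝ) : ℂ))
    (by simpa using h0) (by simpa using h1)
  have e1 : (a : ℂ) + ((1 - a : ℝ) : ℂ) = 1 := by push_cast; ring
  rw [e1, Complex.Gamma_one, one_mul, Complex.betaIntegral,
    intervalIntegral.integral_of_le zero_le_one, integral_Ioc_eq_integral_Ioo,
    Complex.Gamma_ofReal, Complex.Gamma_ofReal] at h
  apply Complex.ofReal_injective
  rw [Complex.ofReal_mul, h, ← integral_complex_ofReal]
  refine setIntegral_congr_fun measurableSet_Ioo ?_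
  intro x hx
  have hx1 : (0:ℝ) < 1 - x := by linarith [hx.2]
  have e : (1 - (x:ℂ)) = ((1 - x : ℝ) : ℂ) := by push_cast; ring
  simp only [Complex.ofReal_mul]
  rw [e, Complex.ofReal_cpow hx.1.le, Complex.ofReal_cpow hx1.le]
  congr 2 <;> push_cast <;> ring

lemma aux_image (R ρ : ℝ) (hR : 0 < R) (h : R < ρ) :
    (fun r : ℝ => ρ ^ 2 / (ρ ^ 2 - R ^ 2) * (1 - R ^ 2 / r ^ 2)) '' Set.Ioo R ρ
      = Set.Ioo 0 1 := by
  have hρ : 0 < ρ := hR.trans h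
  have hD : 0 < ρ ^ 2 - R ^ 2 := by nlinarith
  apply Set.Subset.antisymm
  · rintro _ ⟨r, ⟨h1, h2⟩, rfl⟩
    have hr : 0 < r := hR.trans h1
    have e : ρ ^ 2 / (ρ ^ 2 - R ^ 2) * (1 - R ^ 2 / r ^ 2)
        = ρ ^ 2 * (r ^ 2 - R ^ 2) / ((ρ ^ 2 - R ^ 2) * r ^ 2) := by
      field_simp
    have hrR : 0 < r ^ 2 - R ^ 2 := by nlinarith
    have hrρ : 0 < ρ ^ 2 - r ^ 2 := by nlinarith
    simp only [Set.mem_Ioo]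
    rw [e]
    refine ⟨by positivity, ?_⟩
    rw [div_lt_one (by positivity)]
    have : 0 < R ^ 2 * (ρ ^ 2 - r ^ 2) := by positivity
    nlinarith
  · have := intermediate_value_Ioo (f := fun r : ℝ => ρ ^ 2 / (ρ ^ 2 - R ^ 2) * (1 - R ^ 2 / r ^ 2))
      h.le (by
        refine ContinuousOn.mul continuousOn_const (continuousOn_const.sub
          (continuousOn_const.div (by fun_prop) ?_))
        intro x hx
        have : 0 < x := lt_of_lt_of_le hR hx.1
        positivity)
    have e0 : ρ ^ 2 / (ρ ^ 2 - R ^ 2) * (1 - R ^ 2 / R ^ 2) = 0 := by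
      rw [div_self (by positivity)]; ring
    have e1 : ρ ^ 2 / (ρ ^ 2 - R ^ 2) * (1 - R ^ 2 / ρ ^ 2) = 1 := by
      field_simp
    simp only [e0, e1] at this
    exact this

lemma aux_deriv (R ρ r : ℝ) (hr : 0 < r) :
    HasDerivAt (fun r : ℝ => ρ ^ 2 / (ρ ^ 2 - R ^ 2) * (1 - R ^ 2 / r ^ 2))
      (ρ ^ 2 / (ρ ^ 2 - R ^ 2) * (2 * R ^ 2 / r ^ 3)) r := by
  have h1 : HasDerivAt (fun r : ℝ => r ^ 2) (2 * r) r := by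
    simpa using hasDerivAt_pow 2 r
  have h2 := (((hasDerivAt_const r (R ^ 2)).div h1 (by positivity)).const_sub 1).const_mul
    (ρ ^ 2 / (ρ ^ 2 - R ^ 2))
  refine h2.congr_deriv ?_
  field_simp
  ring

lemma aux_inj (R ρ : ℝ) (hR : 0 < R) (h : R < ρ) :
    Set.InjOn (fun r : ℝ => ρ ^ 2 / (ρ ^ 2 - R ^ 2) * (1 - R ^ 2 / r ^ 2)) (Set.Ioo R ρ) := by
  intro x hx y hy hxy
  have hρ : 0 < ρ := hR.trans h
  have hD : 0 < ρ ^ 2 - R ^ 2 := by nlinarith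
  have hx0 : 0 < x := hR.trans hx.1
  have hy0 : 0 < y := hR.trans hy.1
  have h1 := mul_left_cancel₀ (by positivity) hxy
  have h2 : R ^ 2 / x ^ 2 = R ^ 2 / y ^ 2 := by linarith
  rw [div_eq_div_iff (by positivity) (by positivity)] at h2
  have h3 := mul_left_cancel₀ (by positivity) h2
  exact ((pow_left_inj₀ hy0.le hx0.le two_ne_zero).1 h3).symm

lemma aux_pointwise (a R ρ r : ℝ) (hR : 0 < R) (h1 : R < r) (h2 : r < ρ) :
    |ρ ^ 2 / (ρ ^ 2 - R ^ 2) * (2 * R ^ 2 / r ^ 3)| •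
      ((ρ ^ 2 / (ρ ^ 2 - R ^ 2) * (1 - R ^ 2 / r ^ 2)) ^ (a - 1) *
        (1 - ρ ^ 2 / (ρ ^ 2 - R ^ 2) * (1 - R ^ 2 / r ^ 2)) ^ (-a))
      = (2 * ρ ^ (2 * a) * R ^ (2 - 2 * a)) *
        ((ρ ^ 2 - r ^ 2) ^ (-a) * (r⁻¹ * (r ^ 2 - R ^ 2) ^ (a - 1))) := by
  have hr : 0 < r := hR.trans h1
  have hρ : 0 < ρ := hr.trans h2
  have hD : 0 < ρ ^ 2 - R ^ 2 := by nlinarith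
  have hrR : 0 < r ^ 2 - R ^ 2 := by nlinarith
  have hrρ : 0 < ρ ^ 2 - r ^ 2 := by nlinarith
  have e1 : ρ ^ 2 / (ρ ^ 2 - R ^ 2) * (1 - R ^ 2 / r ^ 2)
      = ρ ^ 2 * (r ^ 2 - R ^ 2) / ((ρ ^ 2 - R ^ 2) * r ^ 2) := by
    field_simp
  have e2 : 1 - ρ ^ 2 * (r ^ 2 - R ^ 2) / ((ρ ^ 2 - R ^ 2) * r ^ 2)
      = R ^ 2 * (ρ ^ 2 - r ^ 2) / ((ρ ^ 2 - R ^ 2) * r ^ 2) := by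
    field_simp
    ring
  rw [abs_of_pos (by positivity), e1, e2, smul_eq_mul]
  generalize hDD : ρ ^ 2 - R ^ 2 = D at *
  generalize r ^ 2 - R ^ 2 = A at *
  generalize ρ ^ 2 - r ^ 2 = B at *
  have p1 : ρ ^ (2 * a) = (ρ ^ 2) ^ a := by
    rw [rpow_mul hρ.le]; norm_num
  have p2 : R ^ (2 - 2 * a) = R ^ 2 / (R ^ 2) ^ a := by
    rw [rpow_sub hR, rpow_mul hR.le]; norm_num
  rw [p1, p2, div_rpow (by positivity) (by positivity), div_rpow (by positivity) (by positivity),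
    mul_rpow (sq_nonneg ρ) hrR.le, mul_rpow (sq_nonneg R) hrρ.le,
    rpow_sub_one (sq_pos_of_pos hρ).ne', rpow_sub_one hrR.ne',
    rpow_sub_one (show D * r ^ 2 ≠ 0 by positivity),
    rpow_neg (sq_nonneg R), rpow_neg hrρ.le, rpow_neg (show 0 ≤ D * r ^ 2 by positivity)]
  have := rpow_pos_of_pos (show 0 < D * r ^ 2 by positivity) a
  have := rpow_pos_of_pos hrρ a
  have := rpow_pos_of_pos (show 0 < R ^ 2 by positivity) a
  generalize (D * r ^ 2) ^ a = X at *
  generalize (R ^ 2) ^ a = Y at *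
  generalize B ^ a = Z at *
  field_simp

/-- The truncated Riesz kernel as an average of Dynkin kernels: for `|z| > R`,
`c_{d,α}|z|^{-d-α} = (4R^{2-α}/(α Γ(α/2)|Γ(-α/2)|)) ·
  ∫_R^{|z|} c_{d,α}|z|^{-d}(|z|²-r²)^{-α/2} · r^{-1}(r²-R²)^{α/2-1} dr`,
the integral being absolutely convergent. -/
theorem truncated_kernel_eq_average_of_dynkin_kernels (d : ℕ) (hd : 1 ≤ d) (α : ℝ)
    (hα : α ∈ Set.Ioo (0:ℝ) 2) (R : ℝ) (hR : 0 < R)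
    (z : EuclideanSpace ℝ (Fin d)) (hz : R < ‖z‖)
    (c : ℝ)
    (hc : c = 2 ^ α * Real.Gamma (((d:ℝ) + α) / 2) /
        (Real.pi ^ ((d:ℝ) / 2) * |Real.Gamma (-(α / 2))|)) :
    IntegrableOn
      (fun r : ℝ => c * ‖z‖ ^ (-(d:ℝ)) * (‖z‖ ^ 2 - r ^ 2) ^ (-(α / 2)) *
        (r⁻¹ * (r ^ 2 - R ^ 2) ^ (α / 2 - 1)))
      (Set.Ioo R ‖z‖) ∧
    c * ‖z‖ ^ (-(d:ℝ) - α)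
      = (4 * R ^ (2 - α) / (α * Real.Gamma (α / 2) * |Real.Gamma (-(α / 2))|)) *
          ∫ r in Set.Ioo R ‖z‖,
            c * ‖z‖ ^ (-(d:ℝ)) * (‖z‖ ^ 2 - r ^ 2) ^ (-(α / 2)) *
              (r⁻¹ * (r ^ 2 - R ^ 2) ^ (α / 2 - 1)) := by
  clear hc
  obtain ⟨ha0, ha2⟩ := hα
  obtain ⟨a, rfl⟩ : ∃ a, α = 2 * a := ⟨α / 2, by ring⟩
  have ea : 2 * a / 2 = a := by ring
  have h0 : 0 < a := by linarith
  have h1 : a < 1 := by linarith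
  generalize ‖z‖ = ρ at *
  have hρ : 0 < ρ := hR.trans hz
  simp only [ea, mul_assoc (c * ρ ^ (-(d:ℝ)))]
  have hder : ∀ x ∈ Set.Ioo R ρ, HasDerivWithinAt
      (fun r : ℝ => ρ ^ 2 / (ρ ^ 2 - R ^ 2) * (1 - R ^ 2 / r ^ 2))
      (ρ ^ 2 / (ρ ^ 2 - R ^ 2) * (2 * R ^ 2 / x ^ 3)) (Set.Ioo R ρ) x :=
    fun x hx => (aux_deriv R ρ x (hR.trans hx.1)).hasDerivWithinAt
  have hpt := fun (r : ℝ) (hr : r ∈ Set.Ioo R ρ) => aux_pointwise a R ρ r hR hr.1 hr.2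
  have hK : 0 < 2 * ρ ^ (2 * a) * R ^ (2 - 2 * a) := by positivity
  have hint := (integrableOn_image_iff_integrableOn_abs_deriv_smul measurableSet_Ioo hder
    (aux_inj R ρ hR hz) (fun u : ℝ => u ^ (a - 1) * (1 - u) ^ (-a))).1
    (by rw [aux_image R ρ hR hz]; exact aux_beta_integrable a h0 h1)
  have hval := integral_image_eq_integral_abs_deriv_smul measurableSet_Ioo hder
    (aux_inj R ρ hR hz) (fun u : ℝ => u ^ (a - 1) * (1 - u) ^ (-a))
  rw [aux_image R ρ hR hz, aux_beta_integral a h0 h1,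
    setIntegral_congr_fun measurableSet_Ioo hpt, integral_const_mul] at hval
  have hint2 := (integrableOn_congr_fun hpt measurableSet_Ioo).1 hint
  constructor
  · have h3 := hint2.const_mul (c * ρ ^ (-(d:ℝ)) / (2 * ρ ^ (2 * a) * R ^ (2 - 2 * a)))
    refine h3.congr (ae_of_all _ fun r => ?_)
    simp only []
    field_simp
  · rw [integral_const_mul]
    generalize (∫ r in Set.Ioo R ρ, (ρ ^ 2 - r ^ 2) ^ (-a) * (r⁻¹ * (r ^ 2 - R ^ 2) ^ (a - 1)))
      = I at *
    have hG : Real.Gamma (1 - a) = a * |Real.Gamma (-a)| := by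
      have h4 := Real.Gamma_add_one (s := -a) (by linarith)
      have h5 : 0 < Real.Gamma (1 - a) := Real.Gamma_pos_of_pos (by linarith)
      rw [show -a + 1 = 1 - a by ring] at h4
      have h6 : Real.Gamma (-a) < 0 := by nlinarith
      rw [abs_of_neg h6, h4]; ring
    have hGp : 0 < |Real.Gamma (-a)| := by
      have h5 : 0 < Real.Gamma (1 - a) := Real.Gamma_pos_of_pos (by linarith)
      rw [hG] at h5
      exact pos_of_mul_pos_right h5 h0.le
    have hGa := Real.Gamma_pos_of_pos h0
    rw [hG] at hval
    rw [rpow_sub hρ]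
    have hp := rpow_pos_of_pos hρ (2 * a)
    generalize ρ ^ (2 * a) = P at *
    generalize R ^ (2 - 2 * a) = Q at *
    generalize |Real.Gamma (-a)| = G at *
    generalize Real.Gamma a = H at *
    field_simp
    linear_combination 2 * c * hval
end

section
/- Let d ≥ 1 be an integer, α ∈ (0, 2), x ∈ ℝ^d, and f : ℝ^d → ℝ a measurable function. Suppose that for every r > 0 the function z ↦ (f(x+z) − f(x))·1_{|z|>r}·|z|^{-d}(|z|² − r²)^{-α/2} is absolutely integrable on ℝ^d, and that c_{d,α} ∫_{|z|>r} (f(x+z) − f(x)) |z|^{-d}(|z|² − r²)^{-α/2} dz converges to a real limit ℓ as r → 0⁺. Then for every r > 0 the function z ↦ (f(x+z) − f(x))·1_{|z|>r}·|z|^{-d-α} is absolutely integrable, and c_{d,α} ∫_{|z|>r} (f(x+z) − f(x)) |z|^{-d-α} dz also converges to ℓ as r → 0⁺. Here c_{d,α} = 2^α Γ((d+α)/2)/(π^{d/2}|Γ(-α/2)|). -/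
open MeasureTheory Real Filter Set Topology

lemma bk_integrable {a : ℝ} (h0 : 0 < a) (h1 : a < 1) :
    Integrable (ProbabilityTheory.betaPDFReal (1 - a) a) ∧
    ∫ t, ProbabilityTheory.betaPDFReal (1 - a) a t = 1 := by
  have hl := ProbabilityTheory.lintegral_betaPDF_eq_one (α := 1 - a) (β := a) (by linarith) h0
  have hnn : ∀ t, 0 ≤ ProbabilityTheory.betaPDFReal (1 - a) a t := by
    intro t
    by_cases ht : 0 < t ∧ t < 1
    · exact (ProbabilityTheory.betaPDFReal_pos ht.1 ht.2 (by linarith) h0).le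
    · rw [ProbabilityTheory.betaPDFReal, if_neg ht]
  have hm := ProbabilityTheory.stronglyMeasurable_betaPDFReal (1 - a) a
  constructor
  · refine ⟨hm.aestronglyMeasurable, ?_⟩
    rw [hasFiniteIntegral_iff_ofReal (Eventually.of_forall hnn)]
    have : ∫⁻ t, ENNReal.ofReal (ProbabilityTheory.betaPDFReal (1 - a) a t) = 1 := hl
    rw [this]; simp
  · rw [integral_eq_lintegral_of_nonneg_ae (Eventually.of_forall hnn) hm.aestronglyMeasurable]
    have : ∫⁻ t, ENNReal.ofReal (ProbabilityTheory.betaPDFReal (1 - a) a t) = 1 := hl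
    rw [this]; simp

lemma bk_exists {a : ℝ} (h0 : 0 < a) (h1 : a < 1) :
    ∃ k : ℝ → ℝ, ∃ b : ℝ, 0 < b ∧ Measurable k ∧ Integrable k ∧ ∫ t, k t = 1 ∧
      (∀ t, 0 < t → t < 1 → k t = b * t ^ (-a) * (1 - t) ^ (a - 1)) ∧
      (∀ t, ¬ (0 < t ∧ t < 1) → k t = 0) := by
  refine ⟨ProbabilityTheory.betaPDFReal (1 - a) a, 1 / ProbabilityTheory.beta (1 - a) a,
    one_div_pos.2 (ProbabilityTheory.beta_pos (by linarith) h0),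
    ProbabilityTheory.measurable_betaPDFReal _ _, (bk_integrable h0 h1).1, (bk_integrable h0 h1).2,
    ?_, ?_⟩
  · intro t ht ht1
    rw [ProbabilityTheory.betaPDFReal, if_pos ⟨ht, ht1⟩]
    congr 3; ring
  · intro t ht
    rw [ProbabilityTheory.betaPDFReal, if_neg ht]

/-- The pointwise Möbius/affine identity. -/
lemma bk_shift {a b : ℝ} {k : ℝ → ℝ} 
    (hk : ∀ t, 0 < t → t < 1 → k t = b * t ^ (-a) * (1 - t) ^ (a - 1))
    (hk0 : ∀ t, ¬ (0 < t ∧ t < 1) → k t = 0) {ρ v : ℝ} (hρ : 0 < ρ) (hv : ρ < v) (t : ℝ) :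
    (if ρ < t * v then k t * (v - ρ / t) ^ (-a) else 0) =
      v ^ (-a) * ((1 - ρ / v)⁻¹ * k ((1 - ρ / v)⁻¹ * (t - ρ / v))) := by
  have hv0 : 0 < v := hρ.trans hv
  have hp1 : ρ / v < 1 := (div_lt_one hv0).2 hv
  have hp0 : 0 < ρ / v := div_pos hρ hv0
  have hc : 0 < 1 - ρ / v := by linarith
  have hiff : ρ < t * v ↔ ρ / v < t := (div_lt_iff₀ hv0).symm
  by_cases h : ρ / v < t
  · rw [if_pos (hiff.2 h)]
    have ht0 : 0 < t := hp0.trans h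
    by_cases ht : t < 1
    · have hs0 : 0 < (1 - ρ / v)⁻¹ * (t - ρ / v) := by
        have : 0 < t - ρ / v := by linarith
        positivity
      have hs1 : 1 - (1 - ρ / v)⁻¹ * (t - ρ / v) = (1 - ρ / v)⁻¹ * (1 - t) := by
        have hi := inv_mul_cancel₀ hc.ne'
        linear_combination -hi
      have hs2 : (1 - ρ / v)⁻¹ * (t - ρ / v) < 1 := by
        have : 0 < (1 - ρ / v)⁻¹ * (1 - t) := mul_pos (inv_pos.2 hc) (by linarith)
        linarith
      rw [hk t ht0 ht, hk _ hs0 hs2, hs1, mul_rpow (inv_pos.2 hc).le (by linarith),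
        mul_rpow (inv_pos.2 hc).le (by linarith)]
      have e1 : t ^ (-a) * (v - ρ / t) ^ (-a) = v ^ (-a) * (t - ρ / v) ^ (-a) := by
        rw [← mul_rpow ht0.le, ← mul_rpow hv0.le (by linarith)]
        · congr 1; field_simp
        · rw [sub_nonneg, div_le_iff₀ ht0]; linarith [hiff.2 h, mul_comm t v]
      have e2 : (1 - ρ / v)⁻¹ * ((1 - ρ / v)⁻¹ ^ (-a) * (1 - ρ / v)⁻¹ ^ (a - 1)) = 1 := by
        rw [← rpow_add (inv_pos.2 hc)]
        have : -a + (a - 1) = -1 := by ring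
        rw [this, rpow_neg_one, inv_inv, inv_mul_cancel₀ hc.ne']
      calc b * t ^ (-a) * (1 - t) ^ (a - 1) * (v - ρ / t) ^ (-a)
          = b * (1 - t) ^ (a - 1) * (t ^ (-a) * (v - ρ / t) ^ (-a)) := by ring
        _ = b * (1 - t) ^ (a - 1) * (v ^ (-a) * (t - ρ / v) ^ (-a)) * 
            ((1 - ρ / v)⁻¹ * ((1 - ρ / v)⁻¹ ^ (-a) * (1 - ρ / v)⁻¹ ^ (a - 1))) := by
              rw [e1, e2, mul_one]
        _ = _ := by ring
    · have hs2 : 1 ≤ (1 - ρ / v)⁻¹ * (t - ρ / v) := by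
        rw [inv_mul_eq_div, le_div_iff₀ hc]; linarith
      rw [hk0 t (by tauto), hk0 _ (by intro h; linarith [h.2])]
      simp
  · rw [if_neg (by rwa [hiff]), hk0]
    · simp
    · rintro ⟨h1, -⟩
      have := (mul_pos_iff_of_pos_left (inv_pos.2 hc)).1 h1
      linarith

lemma dynkin_fubini {E : Type*} [MeasurableSpace E] (μ : Measure E) [SFinite μ]
    {h N : E → ℝ} (hh : Measurable h) (hN : Measurable N) {a b : ℝ} {k : ℝ → ℝ} (hkm : Measurable k)
    (hki : Integrable k) (hk1 : ∫ t, k t = 1)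
    (hb : 0 < b)
    (hk : ∀ t, 0 < t → t < 1 → k t = b * t ^ (-a) * (1 - t) ^ (a - 1))
    (hk0 : ∀ t, ¬ (0 < t ∧ t < 1) → k t = 0) {ρ : ℝ} (hρ : 0 < ρ)
    (hNint : IntegrableOn (fun z => h z * N z ^ (-a)) {z | ρ < N z} μ) :
    Integrable (fun t => k t * ∫ z in {z | ρ / t < N z}, h z * (N z - ρ / t) ^ (-a) ∂μ) ∧
    ∫ z in {z | ρ < N z}, h z * N z ^ (-a) ∂μ = 
      ∫ t, k t * ∫ z in {z | ρ / t < N z}, h z * (N z - ρ / t) ^ (-a) ∂μ := by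
  set G : E × ℝ → ℝ := fun q =>
    if ρ < q.2 * N q.1 then h q.1 * (k q.2 * (N q.1 - ρ / q.2) ^ (-a)) else 0 with hG
  have hGm : Measurable G := by
    refine Measurable.ite ?_ (by fun_prop) (by fun_prop)
    exact measurableSet_lt (by fun_prop) (by fun_prop)
  have hms : ∀ u : ℝ, MeasurableSet {z | u < N z} := fun u => measurableSet_lt (by fun_prop) hN
  have hknn : ∀ t, 0 ≤ k t := by
    intro t
    by_cases ht : 0 < t ∧ t < 1
    · rw [hk t ht.1 ht.2]
      have : 0 < 1 - t := by linarith [ht.2]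
      have := ht.1
      positivity
    · rw [hk0 t ht]
  have hz1 : ∀ z, N z ≤ ρ → ∀ t, G (z, t) = 0 := by
    intro z hz t
    simp only [hG]
    split_ifs with h1
    · have : k t = 0 := by
        apply hk0
        rintro ⟨h2, h3⟩
        nlinarith
      simp [this]
    · rfl
  have hz2 : ∀ z, ρ < N z → ∀ t, G (z, t) = 
      (h z * N z ^ (-a)) * ((1 - ρ / N z)⁻¹ * k ((1 - ρ / N z)⁻¹ * (t - ρ / N z))) := by
    intro z hz t
    rw [mul_assoc, ← bk_shift hk hk0 hρ hz t]
    simp only [hG]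
    split_ifs <;> simp
  have hcpos : ∀ z, ρ < N z → 0 < (1 - ρ / N z)⁻¹ := by
    intro z hz
    have : ρ / N z < 1 := (div_lt_one (hρ.trans hz)).2 hz
    exact inv_pos.2 (by linarith)
  have hsi : ∀ z, ρ < N z → 
      Integrable (fun t => (1 - ρ / N z)⁻¹ * k ((1 - ρ / N z)⁻¹ * (t - ρ / N z))) ∧
      ∫ t, (1 - ρ / N z)⁻¹ * k ((1 - ρ / N z)⁻¹ * (t - ρ / N z)) = 1 := by
    intro z hz
    have hc := hcpos z hz
    constructor
    · exact ((hki.comp_mul_left' hc.ne').comp_sub_right (ρ / N z)).const_mul _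
    · rw [integral_const_mul, 
        integral_sub_right_eq_self (fun t => k ((1 - ρ / N z)⁻¹ * t)) (ρ / N z),
        Measure.integral_comp_mul_left, hk1, abs_of_pos (inv_pos.2 hc)]
      simp only [smul_eq_mul, mul_one]
      exact mul_inv_cancel₀ hc.ne'
  have hGi : ∀ z, Integrable (fun t => G (z, t)) := by
    intro z
    by_cases hz : ρ < N z
    · simp_rw [hz2 z hz]
      exact (hsi z hz).1.const_mul _
    · simp_rw [hz1 z (not_lt.1 hz)]
      exact integrable_zero _ _ _
  have hG1 : ∀ z, ∫ t, G (z, t) = {z | ρ < N z}.indicator (fun z => h z * N z ^ (-a)) z := by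
    intro z
    by_cases hz : ρ < N z
    · simp_rw [hz2 z hz]
      rw [integral_const_mul, (hsi z hz).2, indicator_of_mem (by exact hz), mul_one]
    · simp_rw [hz1 z (not_lt.1 hz)]
      rw [indicator_of_notMem (by exact hz), integral_zero]
  have hG2 : ∀ z, ∫ t, ‖G (z, t)‖ = ‖{z | ρ < N z}.indicator (fun z => h z * N z ^ (-a)) z‖ := by
    intro z
    by_cases hz : ρ < N z
    · simp_rw [hz2 z hz, norm_mul (h z * N z ^ (-a))]
      have : ∀ t, ‖(1 - ρ / N z)⁻¹ * k ((1 - ρ / N z)⁻¹ * (t - ρ / N z))‖ = 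
          (1 - ρ / N z)⁻¹ * k ((1 - ρ / N z)⁻¹ * (t - ρ / N z)) := fun t => 
        Real.norm_of_nonneg (mul_nonneg (hcpos z hz).le (hknn _))
      simp_rw [this]
      rw [integral_const_mul, (hsi z hz).2, indicator_of_mem (by exact hz), mul_one]
    · simp_rw [hz1 z (not_lt.1 hz)]
      rw [indicator_of_notMem (by exact hz)]; simp
  have hGint : Integrable G (μ.prod volume) := by
    rw [integrable_prod_iff hGm.aestronglyMeasurable]
    refine ⟨Eventually.of_forall hGi, ?_⟩
    simp_rw [hG2]
    exact ((integrable_indicator_iff (hms ρ)).2 hNint).norm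
  have hGt : ∀ t, ∫ z, G (z, t) ∂μ = 
      k t * ∫ z in {z | ρ / t < N z}, h z * (N z - ρ / t) ^ (-a) ∂μ := by
    intro t
    by_cases ht : 0 < t ∧ t < 1
    · rw [← integral_const_mul, ← integral_indicator (hms _)]
      congr 1
      ext z
      simp only [hG, indicator, mem_ofPred_eq, div_lt_iff₀ ht.1, mul_comm (N z) t]
      split_ifs
      · ring
      · rfl
    · have : ∀ z, G (z, t) = 0 := by
        intro z; simp [hG, hk0 t ht]
      simp [this, hk0 t ht]
  constructor
  · have := hGint.integral_prod_right
    simpa only [hGt] using this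
  · rw [← integral_indicator (hms ρ)]
    simp_rw [← hG1, ← hGt]
    exact integral_integral_swap hGint

lemma dynkin_abstract {E : Type*} [MeasurableSpace E] (μ : Measure E) [SFinite μ]
    {h N : E → ℝ} (hh : Measurable h) (hN : Measurable N) {a : ℝ} (h0 : 0 < a) (h1 : a < 1)
    (hNint : ∀ ρ, 0 < ρ → IntegrableOn (fun z => h z * N z ^ (-a)) {z | ρ < N z} μ)
    {L : ℝ} (hL : Tendsto (fun ρ => ∫ z in {z | ρ < N z}, h z * (N z - ρ) ^ (-a) ∂μ)
      (𝓝[>] 0) (𝓝 L)) :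
    Tendsto (fun ρ => ∫ z in {z | ρ < N z}, h z * N z ^ (-a) ∂μ) (𝓝[>] 0) (𝓝 L) := by
  obtain ⟨k, b, hb, hkm, hki, hk1, hk, hk0⟩ := bk_exists h0 h1
  have hknn : ∀ t, 0 ≤ k t := by
    intro t
    by_cases ht : 0 < t ∧ t < 1
    · rw [hk t ht.1 ht.2]
      have : 0 < 1 - t := by linarith [ht.2]
      have := ht.1
      positivity
    · rw [hk0 t ht]
  set D : ℝ → ℝ := fun ρ => ∫ z in {z | ρ < N z}, h z * (N z - ρ) ^ (-a) ∂μ with hD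
  have hF := fun (ρ : ℝ) (hρ : 0 < ρ) => 
    dynkin_fubini μ hh hN hkm hki hk1 hb hk hk0 hρ (hNint ρ hρ)
  have hFi : ∀ ρ, 0 < ρ → Integrable (fun t => k t * (D (ρ / t) - L)) := by
    intro ρ hρ
    simp_rw [mul_sub]
    exact (hF ρ hρ).1.sub (hki.mul_const L)
  have hFe : ∀ ρ, 0 < ρ → ∫ z in {z | ρ < N z}, h z * N z ^ (-a) ∂μ - L = 
      ∫ t, k t * (D (ρ / t) - L) := by
    intro ρ hρ
    simp_rw [mul_sub]
    rw [integral_sub (hF ρ hρ).1 (hki.mul_const L), integral_mul_const, hk1, one_mul,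
      (hF ρ hρ).2]
  rw [Metric.tendsto_nhds] at hL ⊢
  intro ε hε
  have hL' := hL (ε / 2) (by positivity)
  rw [eventually_nhdsWithin_iff, Metric.eventually_nhds_iff] at hL'
  obtain ⟨δ', hδ', hball⟩ := hL'
  set δ := δ' / 2 with hδd
  have hδ : 0 < δ := by positivity
  have hDδ : ∀ u, 0 < u → u ≤ δ → |D u - L| ≤ ε / 2 := by
    intro u hu hu'
    have := hball (y := u) (by rw [Real.dist_eq, sub_zero, abs_of_pos hu]; linarith) hu
    exact this.le
  set q : ℝ → ℝ := fun s => |k s * (D (δ / s) - L)| with hq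
  have hqi : Integrable q := (hFi δ hδ).abs
  set C := ∫ s, q s with hC
  have hbound : ∀ ρ, 0 < ρ → ρ ≤ δ → 
      |∫ z in {z | ρ < N z}, h z * N z ^ (-a) ∂μ - L| ≤ ε / 2 + (ρ / δ) ^ (1 - a) * C := by
    intro ρ hρ hρδ
    set κ := ρ / δ with hκ
    have hκ0 : 0 < κ := div_pos hρ hδ
    have hκ1 : κ ≤ 1 := (div_le_one hδ).2 hρδ
    rw [hFe ρ hρ]
    have hQi : Integrable (fun t => κ ^ (-a) * q (κ⁻¹ * t)) := 
      (hqi.comp_mul_left' (inv_ne_zero hκ0.ne')).const_mul _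
    have hQe : ∫ t, κ ^ (-a) * q (κ⁻¹ * t) = κ ^ (1 - a) * C := by
      rw [integral_const_mul, Measure.integral_comp_mul_left, inv_inv, abs_of_pos hκ0, 
        smul_eq_mul, ← mul_assoc, sub_eq_add_neg, add_comm, rpow_add hκ0, rpow_one]
    calc |∫ t, k t * (D (ρ / t) - L)| ≤ ∫ t, |k t * (D (ρ / t) - L)| := abs_integral_le_integral_abs
      _ ≤ ∫ t, (ε / 2 * k t + κ ^ (-a) * q (κ⁻¹ * t)) := by
        refine integral_mono (hFi ρ hρ).abs ((hki.const_mul _).add hQi) ?_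
        intro t
        have hQnn : 0 ≤ κ ^ (-a) * q (κ⁻¹ * t) := by positivity
        change |k t * (D (ρ / t) - L)| ≤ ε / 2 * k t + κ ^ (-a) * q (κ⁻¹ * t)
        by_cases ht : 0 < t ∧ t < 1
        · obtain ⟨ht0, ht1⟩ := ht
          rw [abs_mul, abs_of_nonneg (hknn t)]
          by_cases htκ : κ ≤ t
          · have : ρ / t ≤ δ := by
              rw [div_le_iff₀ ht0]
              rw [hκ, div_le_iff₀ hδ] at htκ
              linarith [mul_comm t δ]
            have := hDδ (ρ / t) (div_pos hρ ht0) this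
            nlinarith [mul_le_mul_of_nonneg_left this (hknn t)]
          · push Not at htκ
            have hs0 : 0 < κ⁻¹ * t := by positivity
            have hs1 : κ⁻¹ * t < 1 := by rw [inv_mul_eq_div]; exact (div_lt_one hκ0).2 htκ
            have hts : t ≤ κ⁻¹ * t := by
              have := (one_le_inv₀ hκ0).2 hκ1
              nlinarith
            have e1 : δ / (κ⁻¹ * t) = ρ / t := by
              rw [hκ]; field_simp
            have e2 : k t ≤ κ ^ (-a) * k (κ⁻¹ * t) := by
              rw [hk t ht0 ht1, hk _ hs0 hs1, mul_rpow (by positivity) ht0.le, inv_rpow hκ0.le]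
              have : (1 - t) ^ (a - 1) ≤ (1 - κ⁻¹ * t) ^ (a - 1) := 
                rpow_le_rpow_of_nonpos (by linarith) (by linarith) (by linarith)
              have hp : 0 < κ ^ (-a) := by positivity
              calc b * t ^ (-a) * (1 - t) ^ (a - 1) ≤ b * t ^ (-a) * (1 - κ⁻¹ * t) ^ (a - 1) := by
                    gcongr
                _ = _ := by field_simp
            have e3 : 0 ≤ ε / 2 * k t := mul_nonneg (by positivity) (hknn t)
            simp only [hq]
            rw [e1, abs_mul, abs_of_nonneg (hknn _)]
            have := mul_le_mul_of_nonneg_right e2 (abs_nonneg (D (ρ / t) - L))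
            linarith
        · rw [hk0 t ht]
          simpa using hQnn
      _ = ε / 2 + κ ^ (1 - a) * C := by
        rw [integral_add (hki.const_mul _) hQi, integral_const_mul, hk1, hQe, mul_one]
  have hlim : Tendsto (fun ρ : ℝ => (ρ / δ) ^ (1 - a) * C) (𝓝[>] 0) (𝓝 0) := by
    have : ContinuousAt (fun ρ : ℝ => (ρ / δ) ^ (1 - a) * C) 0 := by
      refine ContinuousAt.mul (ContinuousAt.rpow_const (by fun_prop) ?_) continuousAt_const
      right; linarith
    have h2 := this.tendsto
    simp only [zero_div, zero_rpow (by linarith : (1 - a) ≠ 0), zero_mul] at h2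
    exact h2.mono_left nhdsWithin_le_nhds
  have hev : ∀ᶠ ρ : ℝ in 𝓝[>] 0, (ρ / δ) ^ (1 - a) * C < ε / 2 := 
    hlim.eventually (gt_mem_nhds (by positivity))
  filter_upwards [hev, Ioc_mem_nhdsGT hδ] with ρ h1 h2
  rw [Real.dist_eq]
  linarith [hbound ρ h2.1 h2.2]


/-- Pointwise convergence in Dynkin's definition of the fractional Laplacian implies
pointwise convergence in the singular-integral (principal value) definition, with the
same value. -/
theorem dynkin_domain_subset_singular_integral_domain (d : ℕ) (hd : 1 ≤ d) (α : ℝ)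
    (hα : α ∈ Set.Ioo (0:ℝ) 2)
    (x : EuclideanSpace ℝ (Fin d)) (f : EuclideanSpace ℝ (Fin d) → ℝ) (hf : Measurable f)
    (c : ℝ)
    (hc : c = 2 ^ α * Real.Gamma (((d:ℝ) + α) / 2) /
        (Real.pi ^ ((d:ℝ) / 2) * |Real.Gamma (-(α / 2))|))
    (ℓ : ℝ)
    (hIntD : ∀ r : ℝ, 0 < r →
      IntegrableOn
        (fun z : EuclideanSpace ℝ (Fin d) =>
          (f (x + z) - f x) * (‖z‖ ^ (-(d:ℝ)) * (‖z‖ ^ 2 - r ^ 2) ^ (-(α / 2))))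
        {z : EuclideanSpace ℝ (Fin d) | r < ‖z‖})
    (hTendD : Filter.Tendsto
      (fun r : ℝ => c * ∫ z in {z : EuclideanSpace ℝ (Fin d) | r < ‖z‖},
        (f (x + z) - f x) * (‖z‖ ^ (-(d:ℝ)) * (‖z‖ ^ 2 - r ^ 2) ^ (-(α / 2))))
      (nhdsWithin 0 (Set.Ioi 0)) (nhds ℓ)) :
    (∀ r : ℝ, 0 < r →
      IntegrableOn
        (fun z : EuclideanSpace ℝ (Fin d) => (f (x + z) - f x) * ‖z‖ ^ (-(d:ℝ) - α))
        {z : EuclideanSpace ℝ (Fin d) | r < ‖z‖}) ∧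
    Filter.Tendsto
      (fun r : ℝ => c * ∫ z in {z : EuclideanSpace ℝ (Fin d) | r < ‖z‖},
        (f (x + z) - f x) * ‖z‖ ^ (-(d:ℝ) - α))
      (nhdsWithin 0 (Set.Ioi 0)) (nhds ℓ) := by
  obtain ⟨hα0, hα2⟩ := hα
  set a := α / 2 with ha
  have ha0 : 0 < a := by positivity
  have ha1 : a < 1 := by rw [ha]; linarith
  have hset : ∀ r : ℝ, 0 < r → {z : EuclideanSpace ℝ (Fin d) | r < ‖z‖} =
      {z : EuclideanSpace ℝ (Fin d) | r ^ 2 < ‖z‖ ^ 2} := by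
    intro r hr
    ext z
    simp only [mem_ofPred_eq]
    exact (pow_lt_pow_iff_left₀ hr.le (norm_nonneg z) two_ne_zero).symm
  have hms : ∀ r : ℝ, MeasurableSet {z : EuclideanSpace ℝ (Fin d) | r < ‖z‖} :=
    fun r => measurableSet_lt measurable_const measurable_norm
  have hpow : ∀ z : EuclideanSpace ℝ (Fin d), 0 < ‖z‖ →
      ‖z‖ ^ (-(d:ℝ) - α) = ‖z‖ ^ (-(d:ℝ)) * (‖z‖ ^ 2) ^ (-a) := by
    intro z hz
    rw [← rpow_natCast, ← rpow_mul hz.le, ← rpow_add hz]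
    congr 1
    rw [ha]; push_cast; ring
  have hI : ∀ r : ℝ, 0 < r →
      IntegrableOn
        (fun z : EuclideanSpace ℝ (Fin d) => (f (x + z) - f x) * ‖z‖ ^ (-(d:ℝ) - α))
        {z : EuclideanSpace ℝ (Fin d) | r < ‖z‖} := by
    intro r hr
    refine Integrable.mono (hIntD r hr) (by
      apply Measurable.aestronglyMeasurable; fun_prop) ?_
    refine (ae_restrict_mem (hms r)).mono ?_
    intro z hz
    have hz' : r < ‖z‖ := hz
    have hz0 : 0 < ‖z‖ := hr.trans hz'
    have hd0 : 0 < ‖z‖ ^ 2 - r ^ 2 := by nlinarith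
    rw [hpow z hz0, norm_mul, norm_mul (f (x + z) - f x)]
    refine mul_le_mul_of_nonneg_left ?_ (norm_nonneg _)
    rw [Real.norm_of_nonneg (by positivity), Real.norm_of_nonneg (by positivity)]
    refine mul_le_mul_of_nonneg_left ?_ (by positivity)
    exact rpow_le_rpow_of_nonpos hd0 (by nlinarith) (by linarith)
  refine ⟨hI, ?_⟩
  set h : EuclideanSpace ℝ (Fin d) → ℝ := fun z => c * ((f (x + z) - f x) * ‖z‖ ^ (-(d:ℝ))) with hh
  have hhm : Measurable h := by fun_prop
  have key := dynkin_abstract (volume : Measure (EuclideanSpace ℝ (Fin d))) (h := h)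
    (N := fun z => ‖z‖ ^ 2) hhm (by fun_prop) ha0 ha1 (L := ℓ) ?_ ?_
  · have hsq : Tendsto (fun r : ℝ => r ^ 2) (𝓝[>] 0) (𝓝[>] 0) := by
      refine tendsto_nhdsWithin_iff.2 ⟨?_, ?_⟩
      · have : Tendsto (fun r : ℝ => r ^ 2) (𝓝 0) (𝓝 (0 ^ 2)) := (continuous_pow 2).tendsto 0
        rw [zero_pow two_ne_zero] at this
        exact this.mono_left nhdsWithin_le_nhds
      · filter_upwards [self_mem_nhdsWithin] with r hr
        exact pow_pos (show (0:ℝ) < r from hr) 2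
    refine (key.comp hsq).congr' ?_
    filter_upwards [self_mem_nhdsWithin] with r hr
    simp only [Function.comp]
    rw [← hset r hr, ← integral_const_mul]
    refine setIntegral_congr_fun (hms r) ?_
    intro z hz
    simp only [hh]
    rw [hpow z (lt_trans hr hz)]
    ring
  · intro ρ hρ
    have hs : 0 < √ρ := Real.sqrt_pos.2 hρ
    have hi := ((hI (√ρ) hs).const_mul c)
    have e : {z : EuclideanSpace ℝ (Fin d) | √ρ < ‖z‖} = {z | ρ < ‖z‖ ^ 2} := by
      rw [hset _ hs, Real.sq_sqrt hρ.le]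
    rw [← e]
    refine IntegrableOn.congr_fun hi ?_ (hms _)
    intro z hz
    simp only [hh]
    rw [hpow z (lt_trans hs hz)]
    ring
  · have hsq : Tendsto (fun r : ℝ => √r) (𝓝[>] 0) (𝓝[>] 0) := by
      refine tendsto_nhdsWithin_iff.2 ⟨?_, ?_⟩
      · have : Tendsto (fun r : ℝ => √r) (𝓝 0) (𝓝 (√0)) := Real.continuous_sqrt.tendsto 0
        rw [Real.sqrt_zero] at this
        exact this.mono_left nhdsWithin_le_nhds
      · filter_upwards [self_mem_nhdsWithin] with r hr
        exact Real.sqrt_pos.2 hr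
    refine (hTendD.comp hsq).congr' ?_
    filter_upwards [self_mem_nhdsWithin] with ρ hρ
    have hρ' : (0:ℝ) < ρ := hρ
    simp only [Function.comp]
    rw [hset _ (Real.sqrt_pos.2 hρ'), Real.sq_sqrt hρ'.le, ← integral_const_mul]
    congr 1
    ext z
    simp only [hh]
    ring
end

section
/- Let d ≥ 1 be an integer, α ∈ (0, 2), x ∈ ℝ^d, and f : ℝ^d → ℝ a measurable function that is integrable on some ball B(x, δ) with δ > 0. Suppose that for every r > 0 the function z ↦ (f(x+z) − f(x))·1_{|z|>r}·|z|^{-d-α} is absolutely integrable on ℝ^d, and that c_{d,α} ∫_{|z|>r} (f(x+z) − f(x)) |z|^{-d-α} dz converges to a real limit ℓ as r → 0⁺. Then for every y > 0 the function z ↦ (f(x+z) − f(x)) q_y(z) is absolutely integrable, and (1/y) ∫_{ℝ^d} (f(x+z) − f(x)) q_y(z) dz converges to ℓ as y → 0⁺, where q_y(z) = c_{d,α} · y · ((y/c_α)^{2/α} + |z|²)^{-(d+α)/2}, c_{d,α} = 2^α Γ((d+α)/2)/(π^{d/2}|Γ(-α/2)|), and c_α = 2^{-α}|Γ(-α/2)|/Γ(α/2).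 -/
open MeasureTheory Real Filter Set Topology

/-- Auxiliary cut-off profile: `φ_a(t) = (t² / (a + t²))^{p/2}`. -/
noncomputable def phiAux (p a t : ℝ) : ℝ := (t ^ 2 / (a + t ^ 2)) ^ (p / 2)

lemma phiAux_nonneg (p a t : ℝ) (ha : 0 < a) : 0 ≤ phiAux p a t := by
  unfold phiAux; positivity

lemma phiAux_le_one (p a t : ℝ) (hp : 0 < p) (ha : 0 < a) : phiAux p a t ≤ 1 := by
  unfold phiAux
  apply Real.rpow_le_one (by positivity) _ (by positivity)
  rw [div_le_one (by positivity)]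
  linarith

lemma phiAux_mul (p a t : ℝ) (ha : 0 < a) (ht : 0 < t) :
    t ^ (-p) * phiAux p a t = (a + t ^ 2) ^ (-(p / 2)) := by
  unfold phiAux
  rw [Real.div_rpow (by positivity) (by positivity), ← Real.rpow_natCast t 2,
    ← Real.rpow_mul ht.le, Real.rpow_neg ht.le, Real.rpow_neg (x := a + _) (by positivity)]
  have : ((2 : ℕ) : ℝ) * (p / 2) = p := by push_cast; ring
  rw [this]
  have := (Real.rpow_pos_of_pos ht p).ne'
  field_simp

lemma lt_phiAux_iff (p a t u : ℝ) (hp : 0 < p) (ha : 0 < a) (ht : 0 ≤ t)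
    (hu : u ∈ Set.Ioo (0:ℝ) 1) :
    u < phiAux p a t ↔ √(a * (u ^ (2 / p) / (1 - u ^ (2 / p)))) < t := by
  have hv0 : 0 < u ^ (2 / p) := Real.rpow_pos_of_pos hu.1 _
  have hv1 : u ^ (2 / p) < 1 := Real.rpow_lt_one hu.1.le hu.2 (by positivity)
  have hup : u = (u ^ (2 / p)) ^ (p / 2) := by
    rw [← Real.rpow_mul hu.1.le]
    have : 2 / p * (p / 2) = 1 := by field_simp
    rw [this, Real.rpow_one]
  unfold phiAux
  generalize u ^ (2 / p) = v at *
  have h1 : 0 < 1 - v := by linarith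
  rw [hup, Real.rpow_lt_rpow_iff hv0.le (by positivity) (by positivity),
    lt_div_iff₀ (by positivity)]
  rcases ht.eq_or_lt with rfl | ht
  · constructor
    · intro h; nlinarith [mul_pos hv0 ha]
    · intro h; exact absurd h (not_lt.2 (Real.sqrt_nonneg _))
  · rw [Real.sqrt_lt' ht, ← mul_div_assoc, div_lt_iff₀ h1]
    constructor <;> intro h <;> linarith

lemma integral_layer (b H : ℝ) (hb0 : 0 ≤ b) (hb1 : b ≤ 1) :
    ∫ u in Set.Ioo (0:ℝ) 1, (Set.Iio b).indicator (fun _ => H) u = H * b := by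
  rw [setIntegral_indicator measurableSet_Iio, Ioo_inter_Iio, min_eq_right hb1,
    setIntegral_const]
  simp [hb0, mul_comm]

lemma aux_main {E : Type*} [NormedAddCommGroup E] [MeasurableSpace E] [BorelSpace E]
    [SecondCountableTopology E]
    (μ : Measure E) [SFinite μ] (p : ℝ) (hp : 0 < p) (a : ℝ) (ha : 0 < a)
    (h : E → ℝ) (hm : Measurable h)
    (hi : Integrable (fun z => h z * phiAux p a ‖z‖) μ) :
    AEStronglyMeasurable (fun u : ℝ =>
      ∫ z in {z : E | √(a * (u ^ (2 / p) / (1 - u ^ (2 / p)))) < ‖z‖}, h z ∂μ)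
      (volume.restrict (Set.Ioo (0:ℝ) 1)) ∧
    ∫ z, h z * phiAux p a ‖z‖ ∂μ = ∫ u in Set.Ioo (0:ℝ) 1,
      ∫ z in {z : E | √(a * (u ^ (2 / p) / (1 - u ^ (2 / p)))) < ‖z‖}, h z ∂μ := by
  have hφm : Measurable (fun z : E => phiAux p a ‖z‖) := by
    unfold phiAux; fun_prop
  set F : E × ℝ → ℝ := {w : E × ℝ | w.2 < phiAux p a ‖w.1‖}.indicator (fun w => h w.1) with hF
  have hFm : Measurable F := by
    apply (hm.comp measurable_fst).indicator
    exact measurableSet_lt measurable_snd (hφm.comp measurable_fst)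
  have hsec : ∀ z u, F (z, u) = (Set.Iio (phiAux p a ‖z‖)).indicator (fun _ => h z) u := by
    intro z u; simp [hF, Set.indicator]
  have hint : ∀ z, ∫ u in Set.Ioo (0:ℝ) 1, F (z, u) = h z * phiAux p a ‖z‖ := by
    intro z
    simp_rw [hsec]
    exact integral_layer _ _ (phiAux_nonneg _ _ _ ha) (phiAux_le_one _ _ _ hp ha)
  have hFi : Integrable F (μ.prod (volume.restrict (Set.Ioo (0:ℝ) 1))) := by
    rw [integrable_prod_iff hFm.aestronglyMeasurable]
    constructor
    · refine Eventually.of_forall fun z => ?_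
      simp_rw [hsec]
      exact (integrable_const (h z)).indicator measurableSet_Iio
    · have : (fun z => ∫ u in Set.Ioo (0:ℝ) 1, ‖F (z, u)‖) =
          fun z => ‖h z * phiAux p a ‖z‖‖ := by
        funext z
        simp_rw [hsec, norm_indicator_eq_indicator_norm]
        rw [integral_layer _ _ (phiAux_nonneg _ _ _ ha) (phiAux_le_one _ _ _ hp ha), norm_mul,
          Real.norm_of_nonneg (phiAux_nonneg p a ‖z‖ ha)]
      rw [this]
      exact hi.norm
  have hsec2 : ∀ u ∈ Set.Ioo (0:ℝ) 1, ∫ z, F (z, u) ∂μ =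
      ∫ z in {z : E | √(a * (u ^ (2 / p) / (1 - u ^ (2 / p)))) < ‖z‖}, h z ∂μ := by
    intro u hu
    rw [← integral_indicator (measurableSet_lt measurable_const measurable_norm)]
    congr 1
    funext z
    simp only [hF, Set.indicator, Set.mem_ofPred_eq,
      lt_phiAux_iff p a ‖z‖ u hp ha (norm_nonneg z) hu]
  constructor
  · refine hFi.swap.integral_prod_left.aestronglyMeasurable.congr ?_
    filter_upwards [ae_restrict_mem measurableSet_Ioo] with u hu
    exact hsec2 u hu
  · calc ∫ z, h z * phiAux p a ‖z‖ ∂μ = ∫ z, (∫ u in Set.Ioo (0:ℝ) 1, F (z, u)) ∂μ := by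
          simp_rw [hint]
      _ = ∫ u in Set.Ioo (0:ℝ) 1, ∫ z, F (z, u) ∂μ := 
          integral_integral_swap (f := fun z u => F (z, u)) hFi
      _ = _ := setIntegral_congr_fun measurableSet_Ioo hsec2

/-- Pointwise convergence in the singular-integral definition of the fractional
Laplacian at `x`, together with local integrability of `f` near `x`, implies pointwise
convergence in the harmonic-extension (Caffarelli–Silvestre) definition at `x`, with
the same value. Here `q_y(z) = c_{d,α} y ((y/c_α)^{2/α} + |z|²)^{-(d+α)/2}`. -/
theorem singular_integral_implies_harmonic_extension (d : ℕ) (hd : 1 ≤ d) (α : ℝ)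
    (hα : α ∈ Set.Ioo (0:ℝ) 2)
    (x : EuclideanSpace ℝ (Fin d)) (f : EuclideanSpace ℝ (Fin d) → ℝ) (hf : Measurable f)
    (δ : ℝ) (hδ : 0 < δ) (hloc : IntegrableOn f (Metric.ball x δ))
    (c cα : ℝ)
    (hc : c = 2 ^ α * Real.Gamma (((d:ℝ) + α) / 2) /
        (Real.pi ^ ((d:ℝ) / 2) * |Real.Gamma (-(α / 2))|))
    (hcα : cα = 2 ^ (-α) * |Real.Gamma (-(α / 2))| / Real.Gamma (α / 2))
    (q : ℝ → EuclideanSpace ℝ (Fin d) → ℝ)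
    (hq : ∀ y : ℝ, ∀ z : EuclideanSpace ℝ (Fin d),
      q y z = c * y * ((y / cα) ^ (2 / α) + ‖z‖ ^ 2) ^ (-(((d:ℝ) + α) / 2)))
    (ℓ : ℝ)
    (hIntI : ∀ r : ℝ, 0 < r →
      IntegrableOn
        (fun z : EuclideanSpace ℝ (Fin d) => (f (x + z) - f x) * ‖z‖ ^ (-(d:ℝ) - α))
        {z : EuclideanSpace ℝ (Fin d) | r < ‖z‖})
    (hTendI : Filter.Tendsto
      (fun r : ℝ => c * ∫ z in {z : EuclideanSpace ℝ (Fin d) | r < ‖z‖},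
        (f (x + z) - f x) * ‖z‖ ^ (-(d:ℝ) - α))
      (nhdsWithin 0 (Set.Ioi 0)) (nhds ℓ)) :
    (∀ y : ℝ, 0 < y →
      Integrable (fun z : EuclideanSpace ℝ (Fin d) => (f (x + z) - f x) * q y z)) ∧
    Filter.Tendsto
      (fun y : ℝ => (1 / y) * ∫ z : EuclideanSpace ℝ (Fin d), (f (x + z) - f x) * q y z)
      (nhdsWithin 0 (Set.Ioi 0)) (nhds ℓ) := by
  obtain ⟨hα0, hα2⟩ := hα
  have hcα0 : 0 < cα := by
    rw [hcα]
    have h1 : 0 < Real.Gamma (α / 2) := Real.Gamma_pos_of_pos (by positivity)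
    have h2 : Real.Gamma (-(α / 2)) ≠ 0 := by
      apply Real.Gamma_ne_zero
      intro m hm
      rcases m with _ | m
      · push_cast at hm; linarith
      · push_cast at hm
        have : (0:ℝ) ≤ m := Nat.cast_nonneg m
        linarith
    have h3 : 0 < |Real.Gamma (-(α / 2))| := abs_pos.2 h2
    positivity
  set p : ℝ := (d:ℝ) + α with hpdef
  have hp : 0 < p := by positivity
  have hpe : -(d:ℝ) - α = -p := by rw [hpdef]; ring
  rw [hpe] at hIntI hTendI
  set h : EuclideanSpace ℝ (Fin d) → ℝ := fun z => (f (x + z) - f x) * ‖z‖ ^ (-p) with hh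
  have hgm : Measurable (fun z => f (x + z) - f x) :=
    (hf.comp (measurable_const_add x)).sub_const _
  have hm : Measurable h := by
    apply hgm.mul; fun_prop
  have hφm : ∀ a, Measurable (fun z : EuclideanSpace ℝ (Fin d) => phiAux p a ‖z‖) := by
    intro a; unfold phiAux; fun_prop
  have key : ∀ a, 0 < a → ∀ z, (f (x + z) - f x) * (a + ‖z‖ ^ 2) ^ (-(p / 2)) =
      h z * phiAux p a ‖z‖ := by
    intro a ha z
    by_cases hz : z = 0
    · simp [hz, hh]
    · rw [← phiAux_mul p a ‖z‖ ha (norm_pos_iff.2 hz), hh]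
      ring
  have hgloc : IntegrableOn (fun z => f (x + z) - f x) (Metric.ball 0 δ) := by
    have h1 : IntegrableOn (fun z => f (x + z)) (Metric.ball 0 δ) := by
      have := ((measurePreserving_add_left volume x).integrableOn_comp_preimage
        (MeasurableEquiv.addLeft x).measurableEmbedding (f := f) (s := Metric.ball x δ)).2 hloc
      have he : (fun z => x + z) ⁻¹' Metric.ball x δ = Metric.ball 0 δ := by
        ext z; simp [dist_eq_norm]
      rw [he] at this
      exact this
    exact h1.sub (integrableOn_const (measure_ball_lt_top.ne))
  have hInt : ∀ a, 0 < a → Integrable (fun z => h z * phiAux p a ‖z‖) := by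
    intro a ha
    rw [← integrableOn_univ]
    have hcov : (Set.univ : Set (EuclideanSpace ℝ (Fin d))) ⊆
        Metric.ball 0 δ ∪ {z | δ / 2 < ‖z‖} := by
      intro z _
      by_cases hz : ‖z‖ < δ
      · left; simpa using hz
      · right; simp only [Set.mem_ofPred_eq]; linarith
    refine IntegrableOn.mono_set (IntegrableOn.union ?_ ?_) hcov
    · simp_rw [← key a ha]
      refine Integrable.mul_bdd (c := a ^ (-(p / 2))) hgloc ?_ ?_
      · apply Measurable.aestronglyMeasurable; fun_prop
      · refine Eventually.of_forall fun z => ?_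
        rw [Real.norm_of_nonneg (by positivity)]
        apply Real.rpow_le_rpow_of_nonpos ha
        · have := sq_nonneg ‖z‖; linarith
        · linarith
    · refine Integrable.mul_bdd (c := 1) (hIntI (δ / 2) (by positivity)) ?_ ?_
      · exact (hφm a).aestronglyMeasurable
      · refine Eventually.of_forall fun z => ?_
        rw [Real.norm_of_nonneg (phiAux_nonneg p a ‖z‖ ha)]
        exact phiAux_le_one _ _ _ hp ha
  set I : ℝ → ℝ := fun r => c * ∫ z in {z : EuclideanSpace ℝ (Fin d) | r < ‖z‖}, h z with hI
  have hapos : ∀ y, 0 < y → 0 < (y / cα) ^ (2 / α) := fun y hy => by positivity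
  have hqe : ∀ y, 0 < y → ∀ z, (f (x + z) - f x) * q y z =
      (c * y) * (h z * phiAux p ((y / cα) ^ (2 / α)) ‖z‖) := by
    intro y hy z
    rw [hq, ← key _ (hapos y hy) z]
    ring
  obtain ⟨M, hM⟩ : ∃ M, ∀ r, 0 < r → ‖I r‖ ≤ M := by
    have hb : ∀ᶠ r in 𝓝[>] (0:ℝ), ‖I r‖ < ‖ℓ‖ + 1 :=
      hTendI.norm.eventually_lt_const (by linarith)
    obtain ⟨r0, hr0, hb⟩ := mem_nhdsGT_iff_exists_Ioo_subset.1 hb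
    have hr0 : 0 < r0 := hr0
    refine ⟨max (‖ℓ‖ + 1) (‖c‖ * ∫ z in {z : EuclideanSpace ℝ (Fin d) | r0 / 2 < ‖z‖}, ‖h z‖),
      fun r hr => ?_⟩
    by_cases hrr : r < r0
    · have : ‖I r‖ < ‖ℓ‖ + 1 := hb ⟨hr, hrr⟩
      exact le_max_of_le_left this.le
    · apply le_max_of_le_right
      rw [hI, norm_mul]
      refine mul_le_mul_of_nonneg_left ?_ (norm_nonneg c)
      refine (norm_integral_le_integral_norm _).trans ?_
      refine setIntegral_mono_set (hIntI (r0 / 2) (by positivity)).norm ?_ ?_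
      · exact Eventually.of_forall fun z => norm_nonneg _
      · refine Eventually.of_forall fun z (hz : r < ‖z‖) => ?_
        change r0 / 2 < ‖z‖
        linarith
  have hρ : ∀ u ∈ Set.Ioo (0:ℝ) 1, 0 < u ^ (2 / p) / (1 - u ^ (2 / p)) := by
    intro u hu
    have hv0 : 0 < u ^ (2 / p) := Real.rpow_pos_of_pos hu.1 _
    have hv1 : u ^ (2 / p) < 1 := Real.rpow_lt_one hu.1.le hu.2 (by positivity)
    exact div_pos hv0 (by linarith)
  constructor
  · intro y hy
    simp_rw [hqe y hy]
    exact (hInt _ (hapos y hy)).const_mul _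
  · have hlim : Tendsto (fun y : ℝ => ∫ u in Set.Ioo (0:ℝ) 1,
        I (√((y / cα) ^ (2 / α) * (u ^ (2 / p) / (1 - u ^ (2 / p)))))) (𝓝[>] 0)
        (𝓝 (∫ u in Set.Ioo (0:ℝ) 1, ℓ)) := by
      apply tendsto_integral_filter_of_dominated_convergence (fun _ => M)
      · filter_upwards [self_mem_nhdsWithin] with y hy
        exact (aux_main volume p hp _ (hapos y hy) h hm (hInt _ (hapos y hy))).1.const_mul c
      · filter_upwards [self_mem_nhdsWithin] with y hy
        filter_upwards [ae_restrict_mem measurableSet_Ioo] with u hu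
        exact hM _ (Real.sqrt_pos.2 (mul_pos (hapos y hy) (hρ u hu)))
      · exact integrable_const M
      · filter_upwards [ae_restrict_mem measurableSet_Ioo] with u hu
        refine hTendI.comp ?_
        refine tendsto_nhdsWithin_iff.2 ⟨?_, ?_⟩
        · have hcont : Continuous (fun y : ℝ =>
              √((y / cα) ^ (2 / α) * (u ^ (2 / p) / (1 - u ^ (2 / p))))) := by
            have : Continuous (fun y : ℝ => (y / cα) ^ (2 / α)) :=
              (continuous_id.div_const cα).rpow_const (fun _ => Or.inr (by positivity))
            exact (this.mul_const _).sqrt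
          have := hcont.tendsto 0
          have h0 : (2 / α) ≠ 0 := by positivity
          simp only [zero_div, Real.zero_rpow h0, zero_mul, Real.sqrt_zero] at this
          exact this.mono_left nhdsWithin_le_nhds
        · filter_upwards [self_mem_nhdsWithin] with y hy
          exact Real.sqrt_pos.2 (mul_pos (hapos y hy) (hρ u hu))
    have hconst : ∫ u in Set.Ioo (0:ℝ) 1, ℓ = ℓ := by simp
    rw [hconst] at hlim
    refine hlim.congr' ?_
    filter_upwards [self_mem_nhdsWithin] with y hy
    have hy : 0 < y := hy
    simp_rw [hqe y hy]
    simp only [hI]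
    rw [integral_const_mul, integral_const_mul,
      (aux_main volume p hp _ (hapos y hy) h hm (hInt _ (hapos y hy))).2]
    field_simp
end

section
/- Let d ≥ 1 be an integer, α ∈ (0, 2), y > 0, and z ∈ ℝ^d. Then c_{d,α} · y · ((y/c_α)^{2/α} + |z|²)^{-(d+α)/2} = (y^{-2/α}/|Γ(-α/2)|) · ∫_0^∞ (4πr)^{-d/2} exp(-|z|²/(4r)) · (y^{-2/α} r)^{-1-α/2} · exp(−1/(4 c_α^{2/α} y^{-2/α} r)) dr, where c_{d,α} = 2^α Γ((d+α)/2)/(π^{d/2}|Γ(-α/2)|) and c_α = 2^{-α}|Γ(-α/2)|/Γ(α/2), and the integral is absolutely convergent. -/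
open MeasureTheory Real Filter Set Topology

lemma aux_inv_gamma (s B : ℝ) (hs : 0 < s) (hB : 0 < B) :
    IntegrableOn (fun r : ℝ => r ^ (-s - 1) * Real.exp (-(B / r))) (Set.Ioi 0) ∧
    ∫ r in Set.Ioi (0:ℝ), r ^ (-s - 1) * Real.exp (-(B / r)) = Real.Gamma s * B ^ (-s) := by
  have key : ∀ r ∈ Set.Ioi (0:ℝ), (|(-1:ℝ)| * r ^ ((-1:ℝ) - 1)) •
      (fun u : ℝ => u ^ (s - 1) * Real.exp (-(B * u))) (r ^ (-1:ℝ))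
      = r ^ (-s - 1) * Real.exp (-(B / r)) := by
    intro r hr
    have hr : 0 < r := hr
    simp only [smul_eq_mul, abs_neg, abs_one, one_mul]
    rw [← Real.rpow_mul hr.le, ← mul_assoc, ← Real.rpow_add hr, Real.rpow_neg_one, div_eq_mul_inv]
    congr 2
    ring
  constructor
  · have h := (integrableOn_Ioi_comp_rpow_iff
      (fun u : ℝ => u ^ (s - 1) * Real.exp (-(B * u))) (p := -1) (by norm_num)).2 (by
        have := integrableOn_rpow_mul_exp_neg_mul_rpow (p := 1) (s := s - 1) (b := B)
          (by linarith) one_pos hB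
        simpa using this)
    exact h.congr_fun key measurableSet_Ioi
  · rw [← setIntegral_congr_fun measurableSet_Ioi key, integral_comp_rpow_Ioi
      (fun u : ℝ => u ^ (s - 1) * Real.exp (-(B * u))) (p := -1) (by norm_num),
      Real.integral_rpow_mul_exp_neg_mul_Ioi hs hB, one_div, Real.inv_rpow hB.le,
      Real.rpow_neg hB.le, mul_comm]

/-- The harmonic-extension kernel `q_y(z) = c_{d,α} y ((y/c_α)^{2/α}+|z|²)^{-(d+α)/2}`
is an explicit integral average of Gauss–Weierstrass kernels:
`q_y(z) = (y^{-2/α}/|Γ(-α/2)|) ∫_0^∞ k_r(z) (y^{-2/α} r)^{-1-α/2}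
  exp(-1/(4 c_α^{2/α} y^{-2/α} r)) dr`,
the integral being absolutely convergent. -/
theorem harmonic_extension_kernel_subordination (d : ℕ) (hd : 1 ≤ d) (α : ℝ)
    (hα : α ∈ Set.Ioo (0:ℝ) 2) (y : ℝ) (hy : 0 < y)
    (z : EuclideanSpace ℝ (Fin d))
    (c cα : ℝ)
    (hc : c = 2 ^ α * Real.Gamma (((d:ℝ) + α) / 2) /
        (Real.pi ^ ((d:ℝ) / 2) * |Real.Gamma (-(α / 2))|))
    (hcα : cα = 2 ^ (-α) * |Real.Gamma (-(α / 2))| / Real.Gamma (α / 2)) :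
    IntegrableOn
      (fun r : ℝ => (4 * Real.pi * r) ^ (-(d:ℝ) / 2) * Real.exp (-‖z‖ ^ 2 / (4 * r)) *
        (y ^ (-2 / α) * r) ^ (-1 - α / 2) *
        Real.exp (-(1 / (4 * cα ^ (2 / α) * y ^ (-2 / α) * r)))) (Set.Ioi 0) ∧
    c * y * ((y / cα) ^ (2 / α) + ‖z‖ ^ 2) ^ (-(((d:ℝ) + α) / 2))
      = (y ^ (-2 / α) / |Real.Gamma (-(α / 2))|) *
          ∫ r in Set.Ioi (0:ℝ),
            (4 * Real.pi * r) ^ (-(d:ℝ) / 2) * Real.exp (-‖z‖ ^ 2 / (4 * r)) *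
              (y ^ (-2 / α) * r) ^ (-1 - α / 2) *
              Real.exp (-(1 / (4 * cα ^ (2 / α) * y ^ (-2 / α) * r))) := by
  obtain ⟨h0, h2⟩ := hα
  have hG : 0 < |Real.Gamma (-(α / 2))| := by
    rw [abs_pos]
    apply Real.Gamma_ne_zero
    intro m hm
    have h1 : (m:ℝ) = α / 2 := by linarith
    have h3 : (0:ℝ) < m := by linarith
    have h4 : (m:ℝ) < 1 := by linarith
    norm_cast at h3 h4
    omega
  have hG2 : 0 < Real.Gamma (α / 2) := Real.Gamma_pos_of_pos (by linarith)
  have hcpos : 0 < cα := by rw [hcα]; positivity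
  clear hcα
  set G := |Real.Gamma (-(α / 2))|
  set s := ((d:ℝ) + α) / 2 with hs
  have hspos : 0 < s := by positivity
  set A := (y / cα) ^ (2 / α) + ‖z‖ ^ 2 with hA
  have hApos : 0 < A := by positivity
  set Y := y ^ (-2 / α) with hY
  have hYpos : 0 < Y := by positivity
  have hYA : (y / cα) ^ (2 / α) = 1 / (cα ^ (2 / α) * Y) := by
    rw [Real.div_rpow hy.le hcpos.le, hY, neg_div, Real.rpow_neg hy.le]
    field_simp
  have hYy : Y * Y ^ (-1 - α / 2) = y := by
    rw [← Real.rpow_one_add' hYpos.le (by linarith), hY, ← Real.rpow_mul hy.le]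
    rw [show -2 / α * (1 + (-1 - α / 2)) = 1 by field_simp; ring, Real.rpow_one]
  obtain ⟨hI, hE⟩ := aux_inv_gamma s (A / 4) hspos (by positivity)
  have key : ∀ r ∈ Set.Ioi (0:ℝ), ((4 * Real.pi) ^ (-(d:ℝ) / 2) * Y ^ (-1 - α / 2)) *
      (r ^ (-s - 1) * Real.exp (-(A / 4 / r))) =
      (4 * Real.pi * r) ^ (-(d:ℝ) / 2) * Real.exp (-‖z‖ ^ 2 / (4 * r)) *
        (Y * r) ^ (-1 - α / 2) *
        Real.exp (-(1 / (4 * cα ^ (2 / α) * Y * r))) := by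
    intro r hr
    have hr : 0 < r := hr
    have e1 : Real.exp (-(A / 4 / r)) = Real.exp (-‖z‖ ^ 2 / (4 * r)) *
        Real.exp (-(1 / (4 * cα ^ (2 / α) * Y * r))) := by
      rw [← Real.exp_add, hA, hYA]
      congr 1
      field_simp
      ring
    have e2 : r ^ (-s - 1) = r ^ (-(d:ℝ) / 2) * r ^ (-1 - α / 2) := by
      rw [← Real.rpow_add hr, hs]
      congr 1
      ring
    rw [e1, e2, Real.mul_rpow (by positivity) hr.le, Real.mul_rpow hYpos.le hr.le]
    ring
  constructor
  · exact IntegrableOn.congr_fun (hI.const_mul _) key measurableSet_Ioi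
  · rw [← setIntegral_congr_fun measurableSet_Ioi key, integral_const_mul, hE, hc,
      Real.div_rpow hApos.le (by norm_num)]
    have e4 : (4:ℝ) ^ (-s) = (2 ^ α)⁻¹ * 4 ^ (-(d:ℝ) / 2) := by
      rw [show (4:ℝ) = 2 ^ (2:ℝ) by norm_num, ← Real.rpow_mul (by norm_num),
        ← Real.rpow_mul (by norm_num), ← Real.rpow_neg (by norm_num),
        ← Real.rpow_add (by norm_num), hs]
      congr 1
      ring
    have e5 : Real.pi ^ (-(d:ℝ) / 2) = (Real.pi ^ ((d:ℝ) / 2))⁻¹ := by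
      rw [neg_div, Real.rpow_neg Real.pi_pos.le]
    rw [Real.mul_rpow (by norm_num) Real.pi_pos.le, e4, e5]
    have h4 : (0:ℝ) < 4 ^ (-(d:ℝ) / 2) := by positivity
    have h5 : (0:ℝ) < 2 ^ α := by positivity
    have h6 : (0:ℝ) < Real.pi ^ ((d:ℝ) / 2) := by positivity
    generalize (4:ℝ) ^ (-(d:ℝ) / 2) = F at *
    generalize A ^ (-s) = AA at *
    generalize Y ^ (-1 - α / 2) = YY at *
    generalize (2:ℝ) ^ α = T at *
    generalize Real.pi ^ ((d:ℝ) / 2) = P at *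
    rw [← hYy]
    field_simp
end

section
/- Let d ≥ 1 be an integer, α ∈ (0, 2), x ∈ ℝ^d, and f : ℝ^d → ℝ a measurable function with ∫_{ℝ^d} (1+|z|)^{-d-α}|f(z)| dz < ∞. For t > 0 set g(t) = ∫_{ℝ^d} (f(x+z) − f(x)) (4πt)^{-d/2} exp(-|z|²/(4t)) dz (these integrals are absolutely convergent). Suppose that t ↦ |g(t)|·t^{-1-α/2} is integrable on (0, ∞), and set ℓ = (1/|Γ(-α/2)|) ∫_0^∞ g(t) t^{-1-α/2} dt. Then for every y > 0 the function z ↦ (f(x+z) − f(x)) q_y(z) is absolutely integrable, and (1/y) ∫_{ℝ^d} (f(x+z) − f(x)) q_y(z) dz converges to ℓ as y → 0⁺, where q_y(z) = c_{d,α} · y · ((y/c_α)^{2/α} + |z|²)^{-(d+α)/2}, c_{d,α} = 2^α Γ((d+α)/2)/(π^{d/2}|Γ(-α/2)|), and c_α = 2^{-α}|Γ(-α/2)|/Γ(α/2). -/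
open MeasureTheory Real Filter Set Topology


/-- The Gamma integral after inversion. -/
lemma gamma_inv_aux (p A : ℝ) (hp : 0 < p) (hA : 0 < A) :
    IntegrableOn (fun t : ℝ => t ^ (-1 - p) * Real.exp (-A / (4 * t))) (Set.Ioi 0) ∧
    ∫ t in Set.Ioi (0:ℝ), t ^ (-1 - p) * Real.exp (-A / (4 * t)) =
      Real.Gamma p * (A / 4) ^ (-p) := by
  have hcongr : ∀ t ∈ Set.Ioi (0:ℝ),
      (|(-1:ℝ)| * t ^ ((-1:ℝ) - 1)) •
        ((fun u : ℝ => u ^ (p - 1) * Real.exp (-(A / 4 * u))) (t ^ (-1:ℝ))) =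
      t ^ (-1 - p) * Real.exp (-A / (4 * t)) := by
    intro t ht
    have ht : 0 < t := ht
    simp only [smul_eq_mul]
    rw [← Real.rpow_mul ht.le, abs_neg, abs_one, one_mul, ← mul_assoc, ← Real.rpow_add ht,
      Real.rpow_neg_one]
    congr 1
    · congr 1; ring
    · congr 1; field_simp
  have hint : IntegrableOn (fun u : ℝ => u ^ (p - 1) * Real.exp (-(A / 4 * u))) (Set.Ioi 0) := by
    have := integrableOn_rpow_mul_exp_neg_mul_rpow (s := p - 1) (p := 1) (b := A / 4)
      (by linarith) one_pos (by positivity)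
    simpa [Real.rpow_one, neg_mul] using this
  constructor
  · have h1 := (integrableOn_Ioi_comp_rpow_iff
      (fun u : ℝ => u ^ (p - 1) * Real.exp (-(A / 4 * u))) (p := -1) (by norm_num)).2 hint
    exact h1.congr_fun hcongr measurableSet_Ioi
  · rw [← setIntegral_congr_fun measurableSet_Ioi hcongr,
      integral_comp_rpow_Ioi (fun u : ℝ => u ^ (p - 1) * Real.exp (-(A / 4 * u))) (by norm_num),
      Real.integral_rpow_mul_exp_neg_mul_Ioi hp (by positivity), mul_comm, one_div,
      Real.inv_rpow (by positivity), Real.rpow_neg (by positivity)]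

lemma kernel_bound_aux {E : Type*} [NormedAddCommGroup E] (x : E) (s p : ℝ) (hs : 0 < s)
    (hp : 0 < p) (z : E) :
    (s + ‖z‖ ^ 2) ^ (-(p / 2)) ≤
      (2 * (1 + ‖x‖) ^ 2 / s + 2) ^ (p / 2) * (1 + ‖x + z‖) ^ (-p) := by
  set K := 2 * (1 + ‖x‖) ^ 2 / s + 2 with hK
  have hKpos : 0 < K := by positivity
  have h0 : 0 < s + ‖z‖ ^ 2 := by positivity
  have h1 : (1 + ‖x + z‖) ^ 2 ≤ K * (s + ‖z‖ ^ 2) := by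
    have ha : 1 + ‖x + z‖ ≤ (1 + ‖x‖) + ‖z‖ := by linarith [norm_add_le x z]
    have hb : (1 + ‖x + z‖) ^ 2 ≤ ((1 + ‖x‖) + ‖z‖) ^ 2 := by gcongr
    have hc : K * s = 2 * (1 + ‖x‖) ^ 2 + 2 * s := by rw [hK]; field_simp
    have hd : 2 * ‖z‖ ^ 2 ≤ K * ‖z‖ ^ 2 := by
      gcongr
      rw [hK]
      have : 0 ≤ 2 * (1 + ‖x‖) ^ 2 / s := by positivity
      linarith
    nlinarith [sq_nonneg ((1 + ‖x‖) - ‖z‖)]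
  have h2 : (1 + ‖x + z‖) ^ p ≤ K ^ (p / 2) * (s + ‖z‖ ^ 2) ^ (p / 2) := by
    rw [← Real.mul_rpow hKpos.le h0.le]
    calc (1 + ‖x + z‖) ^ p = ((1 + ‖x + z‖) ^ 2) ^ (p / 2) := by
          rw [← Real.rpow_natCast, ← Real.rpow_mul (by positivity)]
          congr 1; push_cast; ring
      _ ≤ _ := Real.rpow_le_rpow (by positivity) h1 (by positivity)
  rw [Real.rpow_neg h0.le, Real.rpow_neg (by positivity)]
  have h3 : 0 < (1 + ‖x + z‖) ^ p := by positivity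
  have h4 : 0 < (s + ‖z‖ ^ 2) ^ (p / 2) := by positivity
  rw [← div_eq_mul_inv, inv_eq_one_div, div_le_div_iff₀ h4 h3]
  linarith

/-- If `(1+|z|)^{-d-α} f` is integrable and `f` lies in the domain of Bochner's pointwise
definition of the fractional Laplacian at `x` (with value `ℓ`), then `f` lies in the
domain of the harmonic-extension pointwise definition at `x`, with the same value `ℓ`.
Here `g(t) = ∫ (f(x+z)-f(x)) k_t(z) dz` with `k_t` the Gauss–Weierstrass kernel, and
`q_y(z) = c_{d,α} y ((y/c_α)^{2/α}+|z|²)^{-(d+α)/2}`. -/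
theorem bochner_implies_harmonic_extension_pointwise (d : ℕ) (hd : 1 ≤ d) (α : ℝ)
    (hα : α ∈ Set.Ioo (0:ℝ) 2)
    (x : EuclideanSpace ℝ (Fin d)) (f : EuclideanSpace ℝ (Fin d) → ℝ) (hf : Measurable f)
    (hfint : Integrable (fun z : EuclideanSpace ℝ (Fin d) =>
      (1 + ‖z‖) ^ (-(d:ℝ) - α) * |f z|))
    (c cα : ℝ)
    (hc : c = 2 ^ α * Real.Gamma (((d:ℝ) + α) / 2) /
        (Real.pi ^ ((d:ℝ) / 2) * |Real.Gamma (-(α / 2))|))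
    (hcα : cα = 2 ^ (-α) * |Real.Gamma (-(α / 2))| / Real.Gamma (α / 2))
    (g : ℝ → ℝ)
    (hgabs : ∀ t : ℝ, 0 < t →
      Integrable (fun z : EuclideanSpace ℝ (Fin d) =>
        (f (x + z) - f x) * ((4 * Real.pi * t) ^ (-(d:ℝ) / 2) *
          Real.exp (-‖z‖ ^ 2 / (4 * t)))))
    (hg : ∀ t : ℝ, 0 < t →
      g t = ∫ z : EuclideanSpace ℝ (Fin d),
        (f (x + z) - f x) * ((4 * Real.pi * t) ^ (-(d:ℝ) / 2) *
          Real.exp (-‖z‖ ^ 2 / (4 * t))))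
    (hgint : IntegrableOn (fun t : ℝ => |g t| * t ^ (-1 - α / 2)) (Set.Ioi 0))
    (ℓ : ℝ)
    (hℓ : ℓ = (1 / |Real.Gamma (-(α / 2))|) * ∫ t in Set.Ioi (0:ℝ), g t * t ^ (-1 - α / 2))
    (q : ℝ → EuclideanSpace ℝ (Fin d) → ℝ)
    (hq : ∀ y : ℝ, ∀ z : EuclideanSpace ℝ (Fin d),
      q y z = c * y * ((y / cα) ^ (2 / α) + ‖z‖ ^ 2) ^ (-(((d:ℝ) + α) / 2))) :
    (∀ y : ℝ, 0 < y →
      Integrable (fun z : EuclideanSpace ℝ (Fin d) => (f (x + z) - f x) * q y z)) ∧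
    Filter.Tendsto
      (fun y : ℝ => (1 / y) * ∫ z : EuclideanSpace ℝ (Fin d), (f (x + z) - f x) * q y z)
      (nhdsWithin 0 (Set.Ioi 0)) (nhds ℓ) := by
  obtain ⟨hα0, hα2⟩ := hα
  have hd0 : (0:ℝ) < d := by exact_mod_cast hd
  have hp : 0 < (d:ℝ) + α := by positivity
  have hΓ : 0 < |Real.Gamma (-(α / 2))| := by
    rw [abs_pos]
    apply Real.Gamma_ne_zero
    intro m hm
    rcases m with _ | m
    · simp at hm; linarith
    · push_cast at hm
      have : (0:ℝ) ≤ m := by positivity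
      linarith
  have hcαpos : 0 < cα := by
    rw [hcα]
    have := Real.Gamma_pos_of_pos (show 0 < α / 2 by positivity)
    positivity
  have hm : Measurable (fun z => f (x + z) - f x) := by fun_prop
  -- integrability against the Poisson-type kernel
  have hI : ∀ s : ℝ, 0 < s → Integrable (fun z : EuclideanSpace ℝ (Fin d) =>
      (f (x + z) - f x) * (s + ‖z‖ ^ 2) ^ (-(((d:ℝ) + α) / 2))) := by
    intro s hs
    have i1 := hfint.comp_add_left x
    have i2 : Integrable (fun z : EuclideanSpace ℝ (Fin d) => (1 + ‖z‖) ^ (-((d:ℝ) + α))) :=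
      integrable_one_add_norm (by simp [hα0])
    have i3 := i2.comp_add_left x
    refine Integrable.mono' ((i1.add (i3.mul_const |f x|)).const_mul
      ((2 * (1 + ‖x‖) ^ 2 / s + 2) ^ (((d:ℝ) + α) / 2)))
      (by apply Measurable.aestronglyMeasurable; fun_prop) ?_
    refine Filter.Eventually.of_forall fun z => ?_
    have hb := kernel_bound_aux x s ((d:ℝ) + α) hs hp z
    have h0 : 0 ≤ (s + ‖z‖ ^ 2) ^ (-(((d:ℝ) + α) / 2)) := by positivity
    have h1 : |f (x + z) - f x| ≤ |f (x + z)| + |f x| := abs_sub _ _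
    rw [norm_mul, Real.norm_eq_abs, Real.norm_of_nonneg h0]
    calc _ ≤ (|f (x + z)| + |f x|) * _ := mul_le_mul h1 hb h0 (by positivity)
      _ = _ := by
        simp only [Pi.add_apply]
        rw [show -(d:ℝ) - α = -((d:ℝ) + α) by ring]
        ring
  -- pointwise kernel identity
  have hker : ∀ s : ℝ, 0 < s → ∀ z : EuclideanSpace ℝ (Fin d), ∀ t ∈ Set.Ioi (0:ℝ),
      ((4 * Real.pi * t) ^ (-(d:ℝ) / 2) * Real.exp (-‖z‖ ^ 2 / (4 * t))) *
        (Real.exp (-s / (4 * t)) * t ^ (-1 - α / 2)) =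
      (4 * Real.pi) ^ (-(d:ℝ) / 2) *
        (t ^ (-1 - ((d:ℝ) + α) / 2) * Real.exp (-(s + ‖z‖ ^ 2) / (4 * t))) := by
    intro s hs z t ht
    have ht : 0 < t := ht
    rw [Real.mul_rpow (by positivity) ht.le,
      show -1 - ((d:ℝ) + α) / 2 = -(d:ℝ) / 2 + (-1 - α / 2) by ring, Real.rpow_add ht,
      show -(s + ‖z‖ ^ 2) / (4 * t) = -‖z‖ ^ 2 / (4 * t) + -s / (4 * t) by ring, Real.exp_add]
    ring
  have hkI : ∀ s : ℝ, 0 < s → ∀ z : EuclideanSpace ℝ (Fin d), IntegrableOn (fun t : ℝ =>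
      ((4 * Real.pi * t) ^ (-(d:ℝ) / 2) * Real.exp (-‖z‖ ^ 2 / (4 * t))) *
        (Real.exp (-s / (4 * t)) * t ^ (-1 - α / 2))) (Set.Ioi 0) := by
    intro s hs z
    have := (gamma_inv_aux (((d:ℝ) + α) / 2) (s + ‖z‖ ^ 2) (by positivity) (by positivity)).1
    exact IntegrableOn.congr_fun (this.const_mul ((4 * Real.pi) ^ (-(d:ℝ) / 2)))
      (fun t ht => (hker s hs z t ht).symm) measurableSet_Ioi
  have hkV : ∀ s : ℝ, 0 < s → ∀ z : EuclideanSpace ℝ (Fin d), ∫ t in Set.Ioi (0:ℝ),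
      ((4 * Real.pi * t) ^ (-(d:ℝ) / 2) * Real.exp (-‖z‖ ^ 2 / (4 * t))) *
        (Real.exp (-s / (4 * t)) * t ^ (-1 - α / 2)) =
      |Real.Gamma (-(α / 2))| * c * (s + ‖z‖ ^ 2) ^ (-(((d:ℝ) + α) / 2)) := by
    intro s hs z
    rw [setIntegral_congr_fun measurableSet_Ioi (hker s hs z), integral_const_mul,
      (gamma_inv_aux (((d:ℝ) + α) / 2) (s + ‖z‖ ^ 2) (by positivity) (by positivity)).2,
      Real.div_rpow (by positivity) (by norm_num), hc, Real.mul_rpow (by norm_num) (by positivity)]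
    have e1 : (4:ℝ) ^ (-(d:ℝ) / 2) = 2 ^ (-(d:ℝ)) := by
      rw [show (4:ℝ) = 2 ^ (2:ℝ) by norm_num, ← Real.rpow_mul (by norm_num)]
      congr 1; ring
    have e2 : (4:ℝ) ^ (-(((d:ℝ) + α) / 2)) = (2 ^ (d:ℝ))⁻¹ * (2 ^ α)⁻¹ := by
      rw [show (4:ℝ) = 2 ^ (2:ℝ) by norm_num, ← Real.rpow_mul (by norm_num),
        ← Real.rpow_neg (by norm_num), ← Real.rpow_neg (by norm_num),
        ← Real.rpow_add (by norm_num)]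
      congr 1; ring
    rw [e1, e2, neg_div, Real.rpow_neg (by norm_num), Real.rpow_neg Real.pi_pos.le]
    have p1 : (0:ℝ) < 2 ^ (d:ℝ) := by positivity
    have p2 : (0:ℝ) < 2 ^ α := by positivity
    have p3 : (0:ℝ) < Real.pi ^ ((d:ℝ) / 2) := by positivity
    field_simp
  -- Fubini
  have hF : ∀ s : ℝ, 0 < s → Integrable (fun w : EuclideanSpace ℝ (Fin d) × ℝ =>
      (f (x + w.1) - f x) * (((4 * Real.pi * w.2) ^ (-(d:ℝ) / 2) *
        Real.exp (-‖w.1‖ ^ 2 / (4 * w.2))) *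
        (Real.exp (-s / (4 * w.2)) * w.2 ^ (-1 - α / 2))))
      ((volume : Measure (EuclideanSpace ℝ (Fin d))).prod (volume.restrict (Set.Ioi 0))) := by
    intro s hs
    rw [integrable_prod_iff (by apply Measurable.aestronglyMeasurable; fun_prop)]
    refine ⟨Filter.Eventually.of_forall fun z => (hkI s hs z).const_mul (f (x + z) - f x), ?_⟩
    have := ((hI s hs).norm.const_mul (|Real.Gamma (-(α / 2))| * c))
    refine this.congr (Filter.Eventually.of_forall fun z => ?_)
    simp only
    have h0 : 0 ≤ (s + ‖z‖ ^ 2) ^ (-(((d:ℝ) + α) / 2)) := by positivity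
    rw [norm_mul, Real.norm_of_nonneg h0, mul_left_comm, ← hkV s hs z, ← integral_const_mul]
    refine setIntegral_congr_fun measurableSet_Ioi fun t ht => ?_
    have ht : 0 < t := ht
    rw [norm_mul]
    congr 1
    rw [Real.norm_of_nonneg]
    positivity
  have hgs : ∀ s : ℝ, ∀ t ∈ Set.Ioi (0:ℝ), (∫ z : EuclideanSpace ℝ (Fin d),
      (f (x + z) - f x) * (((4 * Real.pi * t) ^ (-(d:ℝ) / 2) *
        Real.exp (-‖z‖ ^ 2 / (4 * t))) *
        (Real.exp (-s / (4 * t)) * t ^ (-1 - α / 2)))) =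
      Real.exp (-s / (4 * t)) * (g t * t ^ (-1 - α / 2)) := by
    intro s t ht
    rw [hg t ht]
    simp_rw [← mul_assoc]
    rw [integral_mul_const, integral_mul_const]
    ring
  have hmeas : ∀ s : ℝ, 0 < s → AEStronglyMeasurable
      (fun t : ℝ => Real.exp (-s / (4 * t)) * (g t * t ^ (-1 - α / 2)))
      (volume.restrict (Set.Ioi 0)) := by
    intro s hs
    exact (hF s hs).integral_prod_right.aestronglyMeasurable.congr
      ((ae_restrict_mem measurableSet_Ioi).mono fun t ht => hgs s t ht)
  have hswap : ∀ s : ℝ, 0 < s → |Real.Gamma (-(α / 2))| * c *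
      (∫ z : EuclideanSpace ℝ (Fin d),
        (f (x + z) - f x) * (s + ‖z‖ ^ 2) ^ (-(((d:ℝ) + α) / 2))) =
      ∫ t in Set.Ioi (0:ℝ), Real.exp (-s / (4 * t)) * (g t * t ^ (-1 - α / 2)) := by
    intro s hs
    rw [← setIntegral_congr_fun measurableSet_Ioi (hgs s), ← integral_integral_swap (hF s hs),
      ← integral_const_mul]
    congr 1
    ext z
    rw [integral_const_mul, hkV s hs z]
    ring
  have hspos : ∀ y : ℝ, 0 < y → 0 < (y / cα) ^ (2 / α) := fun y hy => by positivity
  have hlim : Filter.Tendsto (fun y : ℝ => ∫ t in Set.Ioi (0:ℝ),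
      Real.exp (-((y / cα) ^ (2 / α)) / (4 * t)) * (g t * t ^ (-1 - α / 2)))
      (nhdsWithin 0 (Set.Ioi 0)) (nhds (∫ t in Set.Ioi (0:ℝ), g t * t ^ (-1 - α / 2))) := by
    refine tendsto_integral_filter_of_dominated_convergence
      (fun t : ℝ => |g t| * t ^ (-1 - α / 2)) ?_ ?_ hgint ?_
    · filter_upwards [self_mem_nhdsWithin] with y hy
      exact hmeas _ (hspos y hy)
    · filter_upwards [self_mem_nhdsWithin] with y hy
      filter_upwards [ae_restrict_mem measurableSet_Ioi] with t ht
      have ht : 0 < t := ht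
      have h1 : Real.exp (-((y / cα) ^ (2 / α)) / (4 * t)) ≤ 1 := by
        rw [Real.exp_le_one_iff, neg_div, neg_nonpos]
        have := hspos y hy
        positivity
      have h2 : 0 ≤ t ^ (-1 - α / 2) := by positivity
      rw [norm_mul, norm_mul, Real.norm_of_nonneg (Real.exp_pos _).le, Real.norm_eq_abs,
        Real.norm_of_nonneg h2]
      exact mul_le_of_le_one_left (by positivity) h1
    · filter_upwards with t
      have hcont : Filter.Tendsto (fun y : ℝ => (y / cα) ^ (2 / α))
          (nhdsWithin 0 (Set.Ioi 0)) (nhds 0) := by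
        have hc0 : Continuous (fun y : ℝ => (y / cα) ^ (2 / α)) :=
          (continuous_id.div_const cα).rpow_const (fun _ => Or.inr (by positivity))
        have := hc0.tendsto 0
        rw [zero_div, Real.zero_rpow (by positivity)] at this
        exact this.mono_left nhdsWithin_le_nhds
      have h2 : Filter.Tendsto (fun y : ℝ => Real.exp (-((y / cα) ^ (2 / α)) / (4 * t)))
          (nhdsWithin 0 (Set.Ioi 0)) (nhds 1) := by
        have := (Real.continuous_exp.tendsto _).comp (hcont.neg.div_const (4 * t))
        simpa [Function.comp_def] using this
      simpa using h2.mul_const (g t * t ^ (-1 - α / 2))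
  constructor
  · intro y hy
    refine ((hI _ (hspos y hy)).const_mul (c * y)).congr (Filter.Eventually.of_forall fun z => ?_)
    simp only [hq]
    ring
  · rw [hℓ]
    refine (hlim.const_mul (1 / |Real.Gamma (-(α / 2))|)).congr' ?_
    filter_upwards [self_mem_nhdsWithin] with y hy
    have hy : 0 < y := hy
    rw [← hswap _ (hspos y hy)]
    have : (∫ z : EuclideanSpace ℝ (Fin d), (f (x + z) - f x) * q y z) =
        c * y * ∫ z : EuclideanSpace ℝ (Fin d),
        (f (x + z) - f x) * ((y / cα) ^ (2 / α) + ‖z‖ ^ 2) ^ (-(((d:ℝ) + α) / 2)) := by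
      rw [← integral_const_mul]
      congr 1
      ext z
      rw [hq]
      ring
    rw [this]
    field_simp
end

section
/- Let d ≥ 1 be an integer, α ∈ (0, 2), and r > 0. Then (2Γ(d/2)/(α π^{d/2} Γ(α/2) |Γ(-α/2)|)) · ∫_{{z ∈ ℝ^d : |z| > r}} r^α · |z|^{-d} (|z|² − r²)^{-α/2} dz = 1, and the integral is absolutely convergent. -/
open MeasureTheory Real Filter Set Topology

lemma beta_aux (a : ℝ) (h0 : 0 < a) (h1 : a < 1) :
    IntegrableOn (fun x : ℝ => x ^ (a - 1) * (1 - x) ^ (-a)) (Ioo 0 1) ∧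
    ∫ x in Ioo (0:ℝ) 1, x ^ (a - 1) * (1 - x) ^ (-a) = Real.Gamma a * Real.Gamma (1 - a) := by
  have hb : 0 < 1 - a := by linarith
  have hI : IntegrableOn (fun x : ℝ => (x : ℂ) ^ ((a:ℂ) - 1) * (1 - (x:ℂ)) ^ (((1 - a : ℝ) : ℂ) - 1))
      (Ioc 0 1) := by
    have := Complex.betaIntegral_convergent (u := (a:ℂ)) (v := ((1 - a : ℝ) : ℂ)) (by simpa)
      (by rw [Complex.ofReal_re]; exact hb)
    rwa [intervalIntegrable_iff_integrableOn_Ioc_of_le (by simp)] at this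
  have key : ∀ x ∈ Ioc (0:ℝ) 1,
      RCLike.re ((x : ℂ) ^ ((a:ℂ) - 1) * (1 - (x:ℂ)) ^ (((1 - a : ℝ) : ℂ) - 1)) =
      x ^ (a - 1) * (1 - x) ^ (-a) := by
    intro x hx
    have e : -a = (1 - a) - 1 := by ring
    rw [e]
    norm_cast
    rw [← Complex.ofReal_cpow hx.1.le, ← Complex.ofReal_cpow (by linarith [hx.2]),
      RCLike.re_to_complex, Complex.re_mul_ofReal, Complex.ofReal_re]
  constructor
  · have h2 : IntegrableOn (fun x : ℝ => x ^ (a - 1) * (1 - x) ^ (-a)) (Ioc 0 1) := by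
      refine IntegrableOn.congr_fun (Integrable.re hI) key measurableSet_Ioc
    exact h2.mono_set Ioo_subset_Ioc_self
  · rw [← integral_Ioc_eq_integral_Ioo, ← setIntegral_congr_fun measurableSet_Ioc key,
      integral_re hI]
    have := ProbabilityTheory.beta_eq_betaIntegralReal a (1 - a) h0 hb
    rw [ProbabilityTheory.beta] at this
    simp only [add_sub_cancel, Real.Gamma_one, div_one] at this
    rw [this, Complex.betaIntegral, intervalIntegral.integral_of_le (by norm_num)]
    rfl

lemma radial_aux (α r : ℝ) (hα : α ∈ Set.Ioo (0:ℝ) 2) (hr : 0 < r) :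
    IntegrableOn (fun y : ℝ => r ^ α * (y⁻¹ * (y ^ 2 - r ^ 2) ^ (-(α / 2)))) (Ioi r) ∧
    ∫ y in Ioi r, r ^ α * (y⁻¹ * (y ^ 2 - r ^ 2) ^ (-(α / 2))) =
      Real.Gamma (α / 2) * Real.Gamma (1 - α / 2) / 2 := by
  obtain ⟨hA, hB⟩ := beta_aux (α / 2) (by linarith [hα.1]) (by linarith [hα.2])
  have himg : (fun y : ℝ => r ^ 2 / y ^ 2) '' Ioi r = Ioo 0 1 := by
    ext u
    constructor
    · rintro ⟨y, hy, rfl⟩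
      have hy' : r < y := hy
      have hy0 : 0 < y := hr.trans hy'
      refine ⟨by positivity, ?_⟩
      show r ^ 2 / y ^ 2 < 1
      rw [div_lt_one (by positivity)]
      gcongr
    · rintro ⟨h0, h1⟩
      refine ⟨r / √u, ?_, ?_⟩
      · show r < r / √u
        rw [lt_div_iff₀ (Real.sqrt_pos.2 h0)]
        have : √u < 1 := by rw [Real.sqrt_lt' one_pos]; simpa using h1
        nlinarith
      · show r ^ 2 / (r / √u) ^ 2 = u
        rw [div_pow, Real.sq_sqrt h0.le]
        field_simp
  have hder : ∀ y ∈ Ioi r, HasDerivWithinAt (fun y : ℝ => r ^ 2 / y ^ 2) (-(2 * r ^ 2 / y ^ 3)) (Ioi r) y := by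
    intro y hy
    have hy0 : 0 < y := hr.trans hy
    have h := ((hasDerivAt_const y (r ^ 2)).div (hasDerivAt_pow 2 y) (by positivity))
    refine (h.congr_deriv ?_).hasDerivWithinAt
    field_simp
    norm_num
    ring
  have hinj : InjOn (fun y : ℝ => r ^ 2 / y ^ 2) (Ioi r) := by
    intro x hx y hy hxy
    have hx0 : 0 < x := hr.trans hx
    have hy0 : 0 < y := hr.trans hy
    simp only at hxy
    rw [div_eq_div_iff (by positivity) (by positivity)] at hxy
    have := mul_left_cancel₀ (by positivity) hxy
    exact ((pow_left_inj₀ hy0.le hx0.le two_ne_zero).1 this).symm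
  have hpt : ∀ y ∈ Ioi r, |-(2 * r ^ 2 / y ^ 3)| •
      ((r ^ 2 / y ^ 2) ^ (α / 2 - 1) * (1 - r ^ 2 / y ^ 2) ^ (-(α / 2))) =
      2 * (r ^ α * (y⁻¹ * (y ^ 2 - r ^ 2) ^ (-(α / 2)))) := by
    intro y hy
    have hy' : r < y := hy
    have hy0 : 0 < y := hr.trans hy
    have hd : 0 < y ^ 2 - r ^ 2 := by nlinarith
    have e1 : 1 - r ^ 2 / y ^ 2 = (y ^ 2 - r ^ 2) / y ^ 2 := by field_simp
    have e2 : r ^ α = (r ^ 2) ^ (α / 2) := by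
      rw [← Real.rpow_natCast, ← Real.rpow_mul hr.le]; congr 1; push_cast; ring
    rw [abs_neg, abs_of_pos (by positivity), e1, e2, Real.rpow_sub_one (by positivity),
      Real.div_rpow (by positivity) (by positivity), Real.div_rpow hd.le (by positivity),
      Real.rpow_neg (sq_nonneg y), smul_eq_mul]
    have : 0 < (y ^ 2) ^ (α / 2) := by positivity
    field_simp
  rw [← himg] at hA hB
  rw [integrableOn_image_iff_integrableOn_abs_deriv_smul measurableSet_Ioi hder hinj,
    integrableOn_congr_fun hpt measurableSet_Ioi] at hA
  rw [integral_image_eq_integral_abs_deriv_smul measurableSet_Ioi hder hinj,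
    setIntegral_congr_fun measurableSet_Ioi hpt, integral_const_mul] at hB
  refine ⟨?_, by linarith⟩
  have := hA.const_mul (1 / 2)
  refine IntegrableOn.congr_fun this (fun y _ => ?_) measurableSet_Ioi
  ring

/-- M. Riesz's Poisson kernel of the ball `B(0,r)` for the fractional Laplacian,
evaluated at the center, integrates to one:
`(2Γ(d/2)/(α π^{d/2} Γ(α/2) |Γ(-α/2)|)) ∫_{|z|>r} r^α |z|^{-d}(|z|²-r²)^{-α/2} dz = 1`,
the integral being absolutely convergent. -/
theorem poisson_kernel_ball_center_prob (d : ℕ) (hd : 1 ≤ d) (α r : ℝ)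
    (hα : α ∈ Set.Ioo (0:ℝ) 2) (hr : 0 < r) :
    IntegrableOn
      (fun z : EuclideanSpace ℝ (Fin d) =>
        r ^ α * (‖z‖ ^ (-(d:ℝ)) * (‖z‖ ^ 2 - r ^ 2) ^ (-(α / 2))))
      {z : EuclideanSpace ℝ (Fin d) | r < ‖z‖} ∧
    (2 * Real.Gamma ((d:ℝ) / 2) /
        (α * Real.pi ^ ((d:ℝ) / 2) * Real.Gamma (α / 2) * |Real.Gamma (-(α / 2))|)) *
      ∫ z in {z : EuclideanSpace ℝ (Fin d) | r < ‖z‖},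
        r ^ α * (‖z‖ ^ (-(d:ℝ)) * (‖z‖ ^ 2 - r ^ 2) ^ (-(α / 2))) = 1 := by
  obtain ⟨hA, hB⟩ := radial_aux α r hα hr
  have : Nonempty (Fin d) := ⟨⟨0, hd⟩⟩
  have : Nontrivial (EuclideanSpace ℝ (Fin d)) := by
    apply Module.nontrivial_of_finrank_pos (R := ℝ)
    rw [finrank_euclideanSpace_fin]; omega
  set g : ℝ → ℝ := fun y => r ^ α * (y ^ (-(d:ℝ)) * (y ^ 2 - r ^ 2) ^ (-(α / 2))) with hg
  have hS : MeasurableSet {z : EuclideanSpace ℝ (Fin d) | r < ‖z‖} :=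
    measurableSet_lt measurable_const measurable_norm
  have hind : indicator {z : EuclideanSpace ℝ (Fin d) | r < ‖z‖} (fun z => g ‖z‖) =
      fun z => (Ioi r).indicator g ‖z‖ := by
    ext z
    simp [indicator]
  have hrad : (fun y : ℝ => y ^ (d - 1) • (Ioi r).indicator g y) =
      (Ioi r).indicator (fun y => r ^ α * (y⁻¹ * (y ^ 2 - r ^ 2) ^ (-(α / 2)))) := by
    ext y
    by_cases hy : y ∈ Ioi r
    · have hy0 : 0 < y := hr.trans hy
      simp only [indicator_of_mem hy, hg, smul_eq_mul]
      have : y ^ (-(d:ℝ)) = (y ^ (d - 1))⁻¹ * y⁻¹ := by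
        rw [Real.rpow_neg hy0.le, Real.rpow_natCast, ← mul_inv, ← pow_succ, Nat.sub_add_cancel hd]
      rw [this]
      field_simp
    · simp [indicator_of_notMem hy]
  have hsub : Ioi r ∩ Ioi (0:ℝ) = Ioi r := by
    rw [inter_eq_left]; exact Ioi_subset_Ioi hr.le
  constructor
  · rw [← integrable_indicator_iff hS]
    change Integrable (indicator _ (fun z : EuclideanSpace ℝ (Fin d) => g ‖z‖)) _
    rw [hind, integrable_fun_norm_addHaar, finrank_euclideanSpace_fin, hrad]
    exact ((integrable_indicator_iff measurableSet_Ioi).2 hA).integrableOn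
  · rw [← integral_indicator hS]
    change _ * ∫ z, (indicator _ (fun z : EuclideanSpace ℝ (Fin d) => g ‖z‖)) z = 1
    rw [hind, integral_fun_norm_addHaar, finrank_euclideanSpace_fin, hrad,
      setIntegral_indicator measurableSet_Ioi, inter_comm, hsub, hB, Measure.real,
      EuclideanSpace.volume_ball]
    have hd0 : (0:ℝ) < d := by exact_mod_cast hd
    have ha : 0 < α / 2 := by linarith [hα.1]
    have hα0 : 0 < α := hα.1
    have h1 : 0 < Real.Gamma (α / 2) := Real.Gamma_pos_of_pos ha
    have h2 : 0 < Real.Gamma (1 - α / 2) := Real.Gamma_pos_of_pos (by linarith [hα.2])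
    have h3 : 0 < Real.Gamma ((d:ℝ) / 2) := Real.Gamma_pos_of_pos (by positivity)
    have h4 : |Real.Gamma (-(α / 2))| = Real.Gamma (1 - α / 2) / (α / 2) := by
      have := Real.Gamma_add_one (s := -(α / 2)) (by linarith)
      rw [show 1 - α / 2 = -(α / 2) + 1 by ring] at h2 ⊢
      rw [this] at h2 ⊢
      rw [abs_of_neg (by nlinarith)]
      field_simp
    have h5 : √π ^ d = π ^ ((d:ℝ) / 2) := by
      rw [Real.sqrt_eq_rpow, ← Real.rpow_natCast, ← Real.rpow_mul pi_pos.le]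
      congr 1; ring
    have h6 : 0 < π ^ ((d:ℝ) / 2) := by positivity
    rw [h4]
    simp only [ENNReal.ofReal_one, one_pow, one_mul, Fintype.card_fin, smul_eq_mul, nsmul_eq_mul]
    rw [h5, Real.Gamma_add_one (by positivity), ENNReal.toReal_ofReal (by positivity)]
    generalize Real.Gamma (1 - α / 2) = G at h2 ⊢
    field_simp
end

section
/- Let d ≥ 1 be an integer, α ∈ (0, 2), and r > 0. Define, for 0 < |z| < r, γ_r(0, z) = (Γ(d/2)/(2^α π^{d/2} (Γ(α/2))²)) · |z|^{α−d} · ∫_0^{(r²−|z|²)/|z|²} s^{α/2−1} (1+s)^{-d/2} ds. Then ∫_{B(0,r)} γ_r(0, z) dz = Γ(d/2) · r^α / (α · 2^{α−1} · Γ(α/2) · Γ((d+α)/2)), and all integrals are absolutely convergent. -/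
open MeasureTheory Real Filter Set Topology

lemma beta_int {a b : ℝ} (ha : 0 < a) (hb : 0 < b) :
    IntegrableOn (fun x : ℝ => x ^ (a - 1) * (1 - x) ^ (b - 1)) (Ioo 0 1) ∧
    ∫ x in Ioo (0:ℝ) 1, x ^ (a - 1) * (1 - x) ^ (b - 1) =
      Real.Gamma a * Real.Gamma b / Real.Gamma (a + b) := by
  have h1 : ∫ x in Ioo (0:ℝ) 1, x ^ (a - 1) * (1 - x) ^ (b - 1) =
      Real.Gamma a * Real.Gamma b / Real.Gamma (a + b) := by
    have := ProbabilityTheory.beta_eq_betaIntegralReal a b ha hb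
    rw [ProbabilityTheory.beta] at this
    rw [this, Complex.betaIntegral, intervalIntegral.integral_of_le zero_le_one,
      ← integral_Ioc_eq_integral_Ioo]
    rw [← RCLike.re_eq_complex_re, ← integral_re]
    · refine setIntegral_congr_fun measurableSet_Ioc fun x hx => ?_
      have : ((x : ℂ) ^ ((a:ℂ) - 1) * (1 - (x:ℂ)) ^ ((b:ℂ) - 1)) =
         ((x ^ (a - 1) * (1 - x) ^ (b - 1) : ℝ) : ℂ) := by
        rw [Complex.ofReal_mul, Complex.ofReal_cpow hx.1.le,
          Complex.ofReal_cpow (by linarith [hx.2])]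
        push_cast; rfl
      simp only [this]
      simp
    · have := Complex.betaIntegral_convergent (u := a) (v := b) (by simpa) (by simpa)
      rwa [intervalIntegrable_iff_integrableOn_Ioc_of_le zero_le_one] at this
  refine ⟨?_, h1⟩
  apply not_imp_comm.1 integral_undef
  rw [h1]
  have := Real.Gamma_pos_of_pos ha
  have := Real.Gamma_pos_of_pos hb
  have := Real.Gamma_pos_of_pos (add_pos ha hb)
  positivity

lemma beta_prime {a b : ℝ} (ha : 0 < a) (hb : 0 < b) :
    IntegrableOn (fun x : ℝ => x ^ (a - 1) * (1 + x) ^ (-(a + b))) (Ioi 0) ∧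
    ∫ x in Ioi (0:ℝ), x ^ (a - 1) * (1 + x) ^ (-(a + b)) =
      Real.Gamma a * Real.Gamma b / Real.Gamma (a + b) := by
  have him : (fun x : ℝ => x / (1 + x)) '' Ioi 0 = Ioo 0 1 := by
    ext y
    constructor
    · rintro ⟨x, hx, rfl⟩
      have hx : 0 < x := hx
      constructor
      · positivity
      · show x / (1 + x) < 1
        rw [div_lt_one (by positivity)]; linarith
    · rintro ⟨h0, h1⟩
      have : 0 < 1 - y := by linarith
      refine ⟨y / (1 - y), ?_, ?_⟩
      · show 0 < y / (1 - y)
        positivity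
      · show y / (1 - y) / (1 + y / (1 - y)) = y
        field_simp
        ring
  have hinj : InjOn (fun x : ℝ => x / (1 + x)) (Ioi 0) := by
    intro x hx y hy h
    have hx : 0 < x := hx
    have hy : 0 < y := hy
    simp only at h
    rw [div_eq_div_iff (by positivity) (by positivity)] at h
    linarith
  have hder : ∀ x ∈ Ioi (0:ℝ), HasDerivWithinAt (fun x : ℝ => x / (1 + x))
      (1 / (1 + x) ^ 2) (Ioi 0) x := by
    intro x hx
    have hx : 0 < x := hx
    have := ((hasDerivAt_id' x).div ((hasDerivAt_id' x).const_add 1)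
      (by positivity)).hasDerivWithinAt (s := Ioi 0)
    exact this.congr_deriv (by ring)
  have heq : ∀ x ∈ Ioi (0:ℝ), |1 / (1 + x) ^ 2| •
      ((x / (1 + x)) ^ (a - 1) * (1 - x / (1 + x)) ^ (b - 1)) =
      x ^ (a - 1) * (1 + x) ^ (-(a + b)) := by
    intro x hx
    have hx : 0 < x := hx
    have h1 : 0 < 1 + x := by positivity
    have e : 1 - x / (1 + x) = (1 + x)⁻¹ := by field_simp; ring
    rw [e, abs_of_pos (by positivity), div_rpow hx.le h1.le, inv_rpow h1.le, smul_eq_mul,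
      ← rpow_natCast, one_div, ← rpow_neg h1.le, ← rpow_neg h1.le, div_eq_mul_inv,
      ← rpow_neg h1.le]
    have : -(a + b) = -((2:ℕ):ℝ) + -(a - 1) + -(b - 1) := by push_cast; ring
    rw [this, rpow_add h1, rpow_add h1]
    ring
  obtain ⟨hi, hv⟩ := beta_int ha hb
  constructor
  · rw [← him, integrableOn_image_iff_integrableOn_abs_deriv_smul measurableSet_Ioi hder hinj] at hi
    exact hi.congr_fun heq measurableSet_Ioi
  · rw [← hv, ← him, integral_image_eq_integral_abs_deriv_smul measurableSet_Ioi hder hinj]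
    exact (setIntegral_congr_fun measurableSet_Ioi heq).symm

lemma inner_pow {α R : ℝ} (hα : 0 < α) (hR : 0 < R) :
    IntegrableOn (fun ρ : ℝ => ρ ^ (α - 1)) (Ioo 0 R) ∧
    ∫ ρ in Ioo 0 R, ρ ^ (α - 1) = R ^ α / α := by
  constructor
  · exact (intervalIntegral.integrableOn_Ioo_rpow_iff hR).2 (by linarith)
  · rw [← integral_Ioc_eq_integral_Ioo, ← intervalIntegral.integral_of_le hR.le,
      integral_rpow (Or.inl (by linarith))]
    simp [hα.ne']

lemma region_iff {r ρ s : ℝ} (hr : 0 < r) (hρ : 0 < ρ) (hs : 0 < s) :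
    ρ ^ 2 * (1 + s) < r ^ 2 ↔ ρ < r * (1 + s) ^ (-(1/2) : ℝ) := by
  have h1 : 0 < 1 + s := by positivity
  rw [rpow_neg h1.le, ← sqrt_eq_rpow, ← div_eq_mul_inv, lt_div_iff₀ (by positivity),
    ← pow_lt_pow_iff_left₀ (by positivity) hr.le two_ne_zero, mul_pow, sq_sqrt h1.le]

lemma region_iff' {r ρ s : ℝ} (hρ : 0 < ρ) :
    ρ ^ 2 * (1 + s) < r ^ 2 ↔ s < (r ^ 2 - ρ ^ 2) / ρ ^ 2 := by
  rw [lt_div_iff₀ (by positivity)]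
  constructor <;> intro h <;> linarith

lemma radial {α r δ : ℝ} (hα : 0 < α) (hr : 0 < r) (hδ : 0 < δ) :
    IntegrableOn (fun ρ : ℝ => ρ ^ (α - 1) * ∫ s in Ioo (0:ℝ) ((r ^ 2 - ρ ^ 2) / ρ ^ 2),
      s ^ (α / 2 - 1) * (1 + s) ^ (-δ / 2)) (Ioi 0) ∧
    ∫ ρ in Ioi (0:ℝ), (ρ ^ (α - 1) * ∫ s in Ioo (0:ℝ) ((r ^ 2 - ρ ^ 2) / ρ ^ 2),
      s ^ (α / 2 - 1) * (1 + s) ^ (-δ / 2)) =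
      r ^ α / α * (Real.Gamma (α / 2) * Real.Gamma (δ / 2) / Real.Gamma (α / 2 + δ / 2)) := by
  set k : ℝ → ℝ := fun s => s ^ (α / 2 - 1) * (1 + s) ^ (-δ / 2) with hk
  let S : Set (ℝ × ℝ) := {p | p.1 ^ 2 * (1 + p.2) < r ^ 2}
  have hS : MeasurableSet S := measurableSet_lt (by fun_prop) (by fun_prop)
  let G : ℝ → ℝ → ℝ := fun ρ s => S.indicator (fun p => p.1 ^ (α - 1) * k p.2) (ρ, s)
  have hGm : Measurable (Function.uncurry G) := by
    have : Function.uncurry G = S.indicator (fun p => p.1 ^ (α - 1) * k p.2) := by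
      ext ⟨a, b⟩; rfl
    rw [this]
    refine Measurable.indicator ?_ hS
    simp only [hk]
    fun_prop
  have hknn : ∀ s ∈ Ioi (0:ℝ), 0 ≤ k s := by
    intro s hs
    have hs : 0 < s := hs
    simp only [hk]; positivity
  -- slices in ρ
  have hsl : ∀ s ∈ Ioi (0:ℝ), ∀ ρ ∈ Ioi (0:ℝ), G ρ s =
      (Ioo 0 (r * (1 + s) ^ (-(1/2) : ℝ))).indicator (fun ρ => ρ ^ (α - 1) * k s) ρ := by
    intro s hs ρ hρ
    have := region_iff hr (mem_Ioi.1 hρ) (mem_Ioi.1 hs)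
    simp only [G, S, indicator, mem_ofPred_eq, mem_Ioo, this, mem_Ioi.1 hρ, true_and]
  have hR : ∀ s ∈ Ioi (0:ℝ), 0 < r * (1 + s) ^ (-(1/2) : ℝ) := by
    intro s hs
    have hs : 0 < s := hs
    positivity
  have hsi : ∀ s ∈ Ioi (0:ℝ), IntegrableOn (fun ρ => G ρ s) (Ioi 0) := by
    intro s hs
    refine IntegrableOn.congr_fun ?_ (fun ρ hρ => (hsl s hs ρ hρ).symm) measurableSet_Ioi
    apply Integrable.integrableOn
    rw [integrable_indicator_iff measurableSet_Ioo]
    exact (inner_pow hα (hR s hs)).1.mul_const _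
  have hsv : ∀ s ∈ Ioi (0:ℝ), ∫ ρ in Ioi 0, G ρ s =
      r ^ α / α * (s ^ (α / 2 - 1) * (1 + s) ^ (-(α / 2 + δ / 2))) := by
    intro s hs
    rw [setIntegral_congr_fun measurableSet_Ioi (hsl s hs), setIntegral_indicator measurableSet_Ioo,
      inter_eq_right.2 Ioo_subset_Ioi_self, integral_mul_const, (inner_pow hα (hR s hs)).2]
    have hs : 0 < s := hs
    have h1 : 0 < 1 + s := by positivity
    rw [mul_rpow hr.le (by positivity), ← rpow_mul h1.le]
    have : -(α / 2 + δ / 2) = -(1/2) * α + (-δ / 2) := by ring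
    rw [this, rpow_add h1]
    simp only [hk]
    ring
  obtain ⟨hbi, hbv⟩ := beta_prime (a := α / 2) (b := δ / 2) (by positivity) (by positivity)
  have hGi : Integrable (Function.uncurry G)
      ((volume.restrict (Ioi (0:ℝ))).prod (volume.restrict (Ioi (0:ℝ)))) := by
    rw [integrable_prod_iff' hGm.aestronglyMeasurable]
    constructor
    · filter_upwards [ae_restrict_mem measurableSet_Ioi] with s hs
      exact hsi s hs
    · refine IntegrableOn.congr_fun (hbi.const_mul (r ^ α / α)) (fun s hs => ?_) measurableSet_Ioi
      rw [← hsv s hs]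
      refine setIntegral_congr_fun measurableSet_Ioi fun ρ hρ => ?_
      have h0 : 0 ≤ G ρ s := by
        rw [hsl s hs ρ hρ]
        refine indicator_nonneg (fun x hx => ?_) _
        exact mul_nonneg (rpow_nonneg hx.1.le _) (hknn s hs)
      simp only [Function.uncurry]
      rw [Real.norm_of_nonneg h0]
  have hGv : ∀ ρ ∈ Ioi (0:ℝ), ∫ s in Ioi (0:ℝ), G ρ s =
      ρ ^ (α - 1) * ∫ s in Ioo (0:ℝ) ((r ^ 2 - ρ ^ 2) / ρ ^ 2), k s := by
    intro ρ hρ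
    have : ∀ s ∈ Ioi (0:ℝ), G ρ s =
        (Ioo 0 ((r ^ 2 - ρ ^ 2) / ρ ^ 2)).indicator (fun s => ρ ^ (α - 1) * k s) s := by
      intro s hs
      have := region_iff' (r := r) (s := s) (mem_Ioi.1 hρ)
      simp only [G, S, indicator, mem_ofPred_eq, mem_Ioo, this, mem_Ioi.1 hs, true_and]
    rw [setIntegral_congr_fun measurableSet_Ioi this, setIntegral_indicator measurableSet_Ioo,
      inter_eq_right.2 Ioo_subset_Ioi_self, integral_const_mul]
  constructor
  · exact IntegrableOn.congr_fun hGi.integral_prod_left hGv measurableSet_Ioi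
  · rw [← setIntegral_congr_fun measurableSet_Ioi hGv, integral_integral_swap hGi,
      setIntegral_congr_fun measurableSet_Ioi hsv, integral_const_mul, hbv]

/-- Total mass of M. Riesz's Green function of the ball `B(0,r)` for the fractional
Laplacian with pole at the center:
`∫_{B(0,r)} γ_r(0,z) dz = Γ(d/2) r^α / (α 2^{α-1} Γ(α/2) Γ((d+α)/2))`,
where for `0 < |z| < r`,
`γ_r(0,z) = (Γ(d/2)/(2^α π^{d/2} Γ(α/2)²)) |z|^{α-d}
  ∫_0^{(r²-|z|²)/|z|²} s^{α/2-1}(1+s)^{-d/2} ds`,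
all integrals being absolutely convergent. -/
theorem green_function_ball_center_mass (d : ℕ) (hd : 1 ≤ d) (α r : ℝ)
    (hα : α ∈ Set.Ioo (0:ℝ) 2) (hr : 0 < r)
    (γ : EuclideanSpace ℝ (Fin d) → ℝ)
    (hγ : ∀ z : EuclideanSpace ℝ (Fin d), 0 < ‖z‖ → ‖z‖ < r →
      γ z = (Real.Gamma ((d:ℝ) / 2) /
          (2 ^ α * Real.pi ^ ((d:ℝ) / 2) * (Real.Gamma (α / 2)) ^ 2)) *
        ‖z‖ ^ (α - (d:ℝ)) *
        ∫ s in Set.Ioo (0:ℝ) ((r ^ 2 - ‖z‖ ^ 2) / ‖z‖ ^ 2),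
          s ^ (α / 2 - 1) * (1 + s) ^ (-(d:ℝ) / 2)) :
    (∀ z : EuclideanSpace ℝ (Fin d), 0 < ‖z‖ → ‖z‖ < r →
      IntegrableOn (fun s : ℝ => s ^ (α / 2 - 1) * (1 + s) ^ (-(d:ℝ) / 2))
        (Set.Ioo 0 ((r ^ 2 - ‖z‖ ^ 2) / ‖z‖ ^ 2))) ∧
    IntegrableOn γ (Metric.ball (0 : EuclideanSpace ℝ (Fin d)) r) ∧
    ∫ z in Metric.ball (0 : EuclideanSpace ℝ (Fin d)) r, γ z
      = Real.Gamma ((d:ℝ) / 2) * r ^ α /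
          (α * 2 ^ (α - 1) * Real.Gamma (α / 2) * Real.Gamma (((d:ℝ) + α) / 2)) := by
  obtain ⟨hα0, hα2⟩ := hα
  have hd0 : (0:ℝ) < d := by exact_mod_cast hd
  have : Nonempty (Fin d) := ⟨⟨0, hd⟩⟩
  have : Nontrivial (EuclideanSpace ℝ (Fin d)) :=
    Module.nontrivial_of_finrank_pos (R := ℝ) (by simp; omega)
  set C : ℝ := Real.Gamma ((d:ℝ) / 2) /
          (2 ^ α * Real.pi ^ ((d:ℝ) / 2) * (Real.Gamma (α / 2)) ^ 2) with hC
  let f : ℝ → ℝ := fun ρ => C * ρ ^ (α - (d:ℝ)) *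
    ∫ s in Set.Ioo (0:ℝ) ((r ^ 2 - ρ ^ 2) / ρ ^ 2),
          s ^ (α / 2 - 1) * (1 + s) ^ (-(d:ℝ) / 2)
  obtain ⟨hri, hrv⟩ := radial hα0 hr hd0
  have hf0 : ∀ ρ, r ≤ ρ → f ρ = 0 := by
    intro ρ hρ
    have h0 : 0 < ρ := hr.trans_le hρ
    have : (r ^ 2 - ρ ^ 2) / ρ ^ 2 ≤ 0 := by
      apply div_nonpos_of_nonpos_of_nonneg _ (by positivity)
      nlinarith
    simp only [f]
    rw [Ioo_eq_empty (not_lt.2 this)]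
    simp
  have hfr : ∀ ρ ∈ Ioi (0:ℝ), C * (ρ ^ (α - 1) * ∫ s in Set.Ioo (0:ℝ) ((r ^ 2 - ρ ^ 2) / ρ ^ 2),
          s ^ (α / 2 - 1) * (1 + s) ^ (-(d:ℝ) / 2)) =
      ρ ^ (Module.finrank ℝ (EuclideanSpace ℝ (Fin d)) - 1) • f ρ := by
    intro ρ hρ
    have hρ : 0 < ρ := hρ
    have : ρ ^ (α - 1) = ρ ^ (d - 1) * ρ ^ (α - (d:ℝ)) := by
      rw [← rpow_natCast, ← rpow_add hρ, Nat.cast_sub hd]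
      congr 1
      push_cast
      ring
    rw [this, finrank_euclideanSpace, Fintype.card_fin, smul_eq_mul]
    simp only [f]
    ring
  have hfi : Integrable (fun z : EuclideanSpace ℝ (Fin d) => f ‖z‖) := by
    rw [integrable_fun_norm_addHaar]
    exact IntegrableOn.congr_fun (hri.const_mul C) hfr measurableSet_Ioi
  have hae : ∀ᵐ z ∂(volume.restrict (Metric.ball (0 : EuclideanSpace ℝ (Fin d)) r)),
      f ‖z‖ = γ z := by
    have h0 : ∀ᵐ z : EuclideanSpace ℝ (Fin d) ∂volume, z ≠ 0 := by
      simp [ae_iff]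
    filter_upwards [ae_restrict_mem measurableSet_ball, ae_restrict_of_ae h0] with z hz hz0
    exact (hγ z (norm_pos_iff.2 hz0) (by simpa using hz)).symm
  refine ⟨?_, ?_, ?_⟩
  · intro z hz hzr
    have hT : 0 < (r ^ 2 - ‖z‖ ^ 2) / ‖z‖ ^ 2 := by
      apply div_pos _ (by positivity)
      nlinarith
    have hb := (inner_pow (α := α / 2) (by positivity) hT).1
    refine Integrable.mono' hb (Measurable.aestronglyMeasurable (by fun_prop)) ?_
    filter_upwards [ae_restrict_mem measurableSet_Ioo] with s hs
    have hs0 : 0 < s := hs.1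
    rw [Real.norm_of_nonneg (by positivity)]
    refine mul_le_of_le_one_right (by positivity) ?_
    exact rpow_le_one_of_one_le_of_nonpos (by linarith) (by linarith)
  · exact hfi.integrableOn.congr hae
  · rw [← integral_congr_ae hae, setIntegral_eq_integral_of_forall_compl_eq_zero
      (fun z hz => hf0 _ (by simpa using hz)), integral_fun_norm_addHaar,
      ← setIntegral_congr_fun measurableSet_Ioi hfr, integral_const_mul, hrv,
      Measure.real, EuclideanSpace.volume_ball]
    have hG1 := Real.Gamma_pos_of_pos (half_pos hd0)
    have hG2 := Real.Gamma_pos_of_pos (half_pos hα0)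
    have hG3 := Real.Gamma_pos_of_pos (add_pos (half_pos hα0) (half_pos hd0))
    have e1 : ((d:ℝ) + α) / 2 = α / 2 + d / 2 := by ring
    have e2 : √π ^ d = π ^ ((d:ℝ) / 2) := by
      rw [sqrt_eq_rpow, ← rpow_natCast, ← rpow_mul pi_pos.le]
      congr 1
      ring
    have hpi : 0 < π ^ ((d:ℝ) / 2) := by positivity
    have h2 : (0:ℝ) < 2 ^ α := by positivity
    rw [finrank_euclideanSpace, Fintype.card_fin, Real.Gamma_add_one (half_pos hd0).ne', e1, e2,
      ENNReal.ofReal_one, one_pow, one_mul, ENNReal.toReal_ofReal (by positivity), hC,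
      rpow_sub two_pos, rpow_one, nsmul_eq_mul, smul_eq_mul]
    field_simp
end

section
/- Let d ≥ 1 be an integer, α ∈ (0, 2), and x ∈ ℝ^d. There exists a measurable function f : ℝ^d → [0, ∞) with f(x) = 0 such that: (i) ∫_{ℝ^d} f(x+z) |z|^{-d-α} dz < ∞ (so that the principal-value limit lim_{r→0⁺} c_{d,α}∫_{|z|>r}(f(x+z)−f(x))|z|^{-d-α}dz exists, i.e., f lies in the domain of the singular-integral definition L_I at x); but (ii) there is a sequence r_n → 0⁺ such that ∫_{|z|>r_n} f(x+z) |z|^{-d} (|z|² − r_n²)^{-α/2} dz = ∞ for every n (so that f does not lie in the domain of Dynkin's definition L_D at x). An explicit example is f(x+z) = Σ_{n=1}^∞ 5^{-n} (|z|² − 4^{-n})^{α/2−1} · 1_{[2^{-n}, 2^{1-n}]}(|z|). -/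
open MeasureTheory Real Filter Set Topology

lemma dk_radial (d : ℕ) (hd : 1 ≤ d) (a : ℝ) (ha : 0 < a) (F : ℝ → ℝ) :
    Integrable (fun z : EuclideanSpace ℝ (Fin d) => (Ioo a (2 * a)).indicator F ‖z‖) ↔
      IntegrableOn (fun r : ℝ => r ^ (d - 1) * F r) (Ioo a (2 * a)) := by
  haveI : Nonempty (Fin d) := ⟨⟨0, hd⟩⟩
  rw [integrable_fun_norm_addHaar (volume : Measure (EuclideanSpace ℝ (Fin d)))
    (f := (Ioo a (2 * a)).indicator F)]
  have h1 : (fun y : ℝ => y ^ (Module.finrank ℝ (EuclideanSpace ℝ (Fin d)) - 1) •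
      (Ioo a (2 * a)).indicator F y) =
      (Ioo a (2 * a)).indicator (fun r : ℝ => r ^ (d - 1) * F r) := by
    funext y
    by_cases hy : y ∈ Ioo a (2 * a)
    · simp [indicator_of_mem hy]
    · simp [indicator_of_notMem hy]
  rw [h1, integrableOn_indicator_iff measurableSet_Ioo]
  have h2 : Ioo a (2 * a) ∩ Ioi 0 = Ioo a (2 * a) :=
    inter_eq_left.2 fun y hy => ha.trans hy.1
  rw [h2]

/-- Radial profile of the building blocks. -/
noncomputable def dkh (α a r : ℝ) : ℝ := r * ((r ^ 2 - a ^ 2) ^ (α / 2) * (r - a)⁻¹)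

lemma dkh_measurable (α a : ℝ) : Measurable (dkh α a) := by
  unfold dkh; fun_prop

lemma dkh_nonneg {α a r : ℝ} (ha : 0 < a) (hr : r ∈ Ioo a (2 * a)) : 0 ≤ dkh α a r := by
  unfold dkh
  have h1 : 0 < r - a := sub_pos.2 hr.1
  have h2 : 0 < r := ha.trans hr.1
  have h3 : 0 ≤ r ^ 2 - a ^ 2 := by nlinarith
  positivity

lemma dk_int (d : ℕ) (hd : 1 ≤ d) (α a : ℝ) (hα : 0 < α) (ha : 0 < a) :
    Integrable (fun z : EuclideanSpace ℝ (Fin d) =>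
      (Ioo a (2 * a)).indicator (fun r => dkh α a r * r ^ (-(d:ℝ) - α)) ‖z‖) := by
  rw [dk_radial d hd a ha]
  have h0 : IntervalIntegrable (fun r : ℝ => (r - a) ^ (α / 2 - 1)) volume a (2 * a) := by
    have := (intervalIntegral.intervalIntegrable_rpow' (a := 0) (b := a) (r := α / 2 - 1)
      (by linarith)).comp_sub_right a
    simpa [two_mul] using this
  have h1 : IntervalIntegrable (fun r : ℝ => (r ^ (-α) * (r + a) ^ (α / 2)) *
      (r - a) ^ (α / 2 - 1)) volume a (2 * a) := by
    apply h0.continuousOn_mul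
    rw [uIcc_of_le (by linarith)]
    apply ContinuousOn.mul
    · exact continuousOn_id.rpow_const fun r hr => Or.inl (by have := hr.1; simp; linarith)
    · exact (continuousOn_id.add continuousOn_const).rpow_const
        fun r hr => Or.inl (by have := hr.1; simp; linarith)
  rw [intervalIntegrable_iff_integrableOn_Ioo_of_le (by linarith)] at h1
  refine h1.congr_fun ?_ measurableSet_Ioo
  intro r hr
  have h1 : 0 < r - a := sub_pos.2 hr.1
  have h2 : 0 < r := ha.trans hr.1
  have e1 : r ^ 2 - a ^ 2 = (r + a) * (r - a) := by ring
  have e2 : (r ^ (d - 1) : ℝ) * r * r ^ (-(d:ℝ) - α) = r ^ (-α) := by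
    rw [← pow_succ, Nat.sub_add_cancel hd, ← Real.rpow_natCast, ← Real.rpow_add h2]
    congr 1; ring
  simp only [dkh]
  rw [e1, Real.mul_rpow (by linarith) h1.le, ← e2, Real.rpow_sub_one h1.ne']
  field_simp

lemma dk_nonint (d : ℕ) (hd : 1 ≤ d) (α a : ℝ) (ha : 0 < a) :
    ¬ Integrable (fun z : EuclideanSpace ℝ (Fin d) =>
      (Ioo a (2 * a)).indicator
        (fun r => dkh α a r * (r ^ (-(d:ℝ)) * (r ^ 2 - a ^ 2) ^ (-(α / 2)))) ‖z‖) := by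
  rw [dk_radial d hd a ha]
  intro h
  have h1 : IntegrableOn (fun r : ℝ => (r - a)⁻¹) (Ioo a (2 * a)) := by
    refine h.congr_fun ?_ measurableSet_Ioo
    intro r hr
    have h1 : 0 < r - a := sub_pos.2 hr.1
    have h2 : 0 < r := ha.trans hr.1
    have h3 : 0 < r ^ 2 - a ^ 2 := by nlinarith
    have e2 : (r ^ (d - 1) : ℝ) * r * r ^ (-(d:ℝ)) = 1 := by
      rw [← pow_succ, Nat.sub_add_cancel hd, ← Real.rpow_natCast, ← Real.rpow_add h2]
      simp
    have e3 : (r ^ 2 - a ^ 2) ^ (α / 2) * (r ^ 2 - a ^ 2) ^ (-(α / 2)) = 1 := by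
      rw [← Real.rpow_add h3]; simp
    simp only [dkh]
    calc _ = (r ^ (d - 1) * r * r ^ (-(d:ℝ))) *
          ((r ^ 2 - a ^ 2) ^ (α / 2) * (r ^ 2 - a ^ 2) ^ (-(α / 2))) * (r - a)⁻¹ := by ring
      _ = _ := by rw [e2, e3]; ring
  rw [← intervalIntegrable_iff_integrableOn_Ioo_of_le (by linarith),
    intervalIntegrable_sub_inv_iff] at h1
  rcases h1 with h1 | h1
  · linarith
  · exact h1 left_mem_uIcc

/-- The pointwise domain of Dynkin's definition of the fractional Laplacian at `x` is a
proper subset of that of the singular-integral definition: there is a nonnegative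
measurable `f` with `f(x) = 0` such that `∫ f(x+z)|z|^{-d-α} dz < ∞` (hence the
principal-value limit exists, so `f ∈ 𝒟(L_I, x)`), yet along some sequence `r_n → 0⁺`
the Dynkin integrals `∫_{|z|>r_n} f(x+z)|z|^{-d}(|z|²-r_n²)^{-α/2} dz` are infinite
(so `f ∉ 𝒟(L_D, x)`). -/
theorem dynkin_domain_proper_subset (d : ℕ) (hd : 1 ≤ d) (α : ℝ)
    (hα : α ∈ Set.Ioo (0:ℝ) 2) (x : EuclideanSpace ℝ (Fin d))
    (c : ℝ)
    (hc : c = 2 ^ α * Real.Gamma (((d:ℝ) + α) / 2) /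
        (Real.pi ^ ((d:ℝ) / 2) * |Real.Gamma (-(α / 2))|)) :
    ∃ f : EuclideanSpace ℝ (Fin d) → ℝ,
      Measurable f ∧ (∀ z, 0 ≤ f z) ∧ f x = 0 ∧
      Integrable (fun z : EuclideanSpace ℝ (Fin d) => f (x + z) * ‖z‖ ^ (-(d:ℝ) - α)) ∧
      (∃ ℓ : ℝ, Filter.Tendsto
        (fun r : ℝ => c * ∫ z in {z : EuclideanSpace ℝ (Fin d) | r < ‖z‖},
          (f (x + z) - f x) * ‖z‖ ^ (-(d:ℝ) - α))
        (nhdsWithin 0 (Set.Ioi 0)) (nhds ℓ)) ∧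
      ∃ rs : ℕ → ℝ, (∀ n, 0 < rs n) ∧
        Filter.Tendsto rs Filter.atTop (nhds 0) ∧
        ∀ n, ∫⁻ z in {z : EuclideanSpace ℝ (Fin d) | rs n < ‖z‖},
          ENNReal.ofReal (f (x + z) * (‖z‖ ^ (-(d:ℝ)) * (‖z‖ ^ 2 - (rs n) ^ 2) ^ (-(α / 2))))
            = ⊤ := by
  classical
  obtain ⟨hα0, hα2⟩ := hα
  set rs : ℕ → ℝ := fun n => (1 / 2 : ℝ) ^ n with hrs
  have hpos : ∀ n, 0 < rs n := fun n => by simp only [hrs]; positivity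
  let H : ℕ → EuclideanSpace ℝ (Fin d) → ℝ := fun n z =>
    (Ioo (rs n) (2 * rs n)).indicator (dkh α (rs n)) ‖z‖
  have hHm : ∀ n, Measurable (H n) := fun n =>
    ((dkh_measurable α (rs n)).indicator measurableSet_Ioo).comp measurable_norm
  let K : EuclideanSpace ℝ (Fin d) → ℝ := fun z => ‖z‖ ^ (-(d:ℝ) - α)
  have hKm : Measurable K := by
    simp only [K]; fun_prop
  have hK0 : ∀ z, 0 ≤ K z := fun z => Real.rpow_nonneg (norm_nonneg z) _
  have hH0 : ∀ n z, 0 ≤ H n z := fun n z =>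
    indicator_nonneg (fun r hr => dkh_nonneg (hpos n) hr) _
  have hHK : ∀ n, Integrable (fun z => H n z * K z) := fun n => by
    refine (dk_int d hd α (rs n) hα0 (hpos n)).congr (Filter.Eventually.of_forall fun z => ?_)
    by_cases hz : ‖z‖ ∈ Ioo (rs n) (2 * rs n)
    · simp [H, K, indicator_of_mem hz]
    · simp only [H, K, indicator_of_notMem hz, zero_mul]
  obtain ⟨δ, hδ, hsum⟩ := ENNReal.exists_pos_tsum_mul_lt_of_countable one_ne_zero
    (fun n => ∫⁻ z, ENNReal.ofReal (H n z * K z)) (fun n => (hHK n).lintegral_lt_top.ne)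
  let G : EuclideanSpace ℝ (Fin d) → ENNReal := fun z =>
    ∑' n, (δ n : ENNReal) * ENNReal.ofReal (H n z)
  have hGm : Measurable G :=
    Measurable.ennreal_tsum fun n => (hHm n).ennreal_ofReal.const_mul _
  have hG0 : G 0 = 0 := by
    simp only [G, ENNReal.tsum_eq_zero]
    intro n
    have : ‖(0 : EuclideanSpace ℝ (Fin d))‖ ∉ Ioo (rs n) (2 * rs n) := fun h => by
      have := h.1; rw [norm_zero] at this; linarith [hpos n]
    simp only [H, indicator_of_notMem this, ENNReal.ofReal_zero, mul_zero]
  have hGK : ∫⁻ z, G z * ENNReal.ofReal (K z) < ⊤ := by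
    refine lt_of_eq_of_lt ?_ (hsum.trans ENNReal.one_lt_top)
    calc ∫⁻ z, G z * ENNReal.ofReal (K z)
        = ∫⁻ z, ∑' n, (δ n : ENNReal) * ENNReal.ofReal (H n z * K z) := by
          congr 1; funext z
          simp only [G]
          rw [← ENNReal.tsum_mul_right]
          congr 1; funext n
          rw [ENNReal.ofReal_mul (hH0 n z), mul_assoc]
      _ = ∑' n, ∫⁻ z, (δ n : ENNReal) * ENNReal.ofReal (H n z * K z) :=
          lintegral_tsum fun n =>
            (((hHm n).mul hKm).ennreal_ofReal.const_mul _).aemeasurable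
      _ = _ := by
          congr 1; funext n
          have hm : Measurable fun z => ENNReal.ofReal (H n z * K z) :=
            ((hHm n).mul hKm).ennreal_ofReal
          rw [lintegral_const_mul _ hm, mul_comm]
  have hGfin : ∀ᵐ z, G z < ⊤ := by
    filter_upwards [ae_lt_top (hGm.mul hKm.ennreal_ofReal) hGK.ne] with z hz
    by_cases hz0 : z = 0
    · rw [hz0, hG0]; exact ENNReal.zero_lt_top
    · by_contra hcon
      rw [not_lt_top_iff] at hcon
      have hKp : 0 < K z := Real.rpow_pos_of_pos (norm_pos_iff.2 hz0) _
      change G z * ENNReal.ofReal (K z) < ⊤ at hz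
      rw [hcon] at hz
      rw [ENNReal.top_mul (by simpa using hKp)] at hz
      exact lt_irrefl _ hz
  have hint : Integrable (fun z => (G z).toReal * K z) := by
    refine ⟨(hGm.ennreal_toReal.mul hKm).aestronglyMeasurable, ?_⟩
    rw [hasFiniteIntegral_iff_ofReal
      (Filter.Eventually.of_forall fun z => mul_nonneg ENNReal.toReal_nonneg (hK0 z))]
    refine lt_of_le_of_lt (lintegral_mono fun z => ?_) hGK
    rw [ENNReal.ofReal_mul ENNReal.toReal_nonneg]
    gcongr
    exact ENNReal.ofReal_toReal_le
  refine ⟨fun y => (G (y - x)).toReal, ?_, fun _ => ENNReal.toReal_nonneg, ?_, ?_, ?_,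
    rs, hpos, ?_, ?_⟩
  · exact (hGm.comp (measurable_id.sub_const x)).ennreal_toReal
  · simp [hG0]
  · simpa only [add_sub_cancel_left] using hint
  · refine ⟨c * ∫ z in {z : EuclideanSpace ℝ (Fin d) | 0 < ‖z‖}, (G z).toReal * K z, ?_⟩
    refine Filter.Tendsto.const_mul c ?_
    simp only [add_sub_cancel_left, sub_self, hG0, ENNReal.toReal_zero, sub_zero]
    have hms : ∀ r : ℝ, MeasurableSet {z : EuclideanSpace ℝ (Fin d) | r < ‖z‖} := fun r =>
      measurableSet_lt measurable_const measurable_norm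
    simp_rw [← integral_indicator (hms _)]
    refine tendsto_integral_filter_of_dominated_convergence
      (fun z => ‖(G z).toReal * K z‖) ?_ ?_ hint.norm ?_
    · exact Filter.Eventually.of_forall fun r => hint.aestronglyMeasurable.indicator (hms r)
    · exact Filter.Eventually.of_forall fun r => Filter.Eventually.of_forall fun z =>
        norm_indicator_le_norm_self _ _
    · refine Filter.Eventually.of_forall fun z => ?_
      refine tendsto_const_nhds.congr' ?_
      by_cases hz : z = 0
      · filter_upwards [self_mem_nhdsWithin] with r hr
        have hr' : (0:ℝ) < r := hr
        rw [indicator_of_notMem (by simp [hz]),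
          indicator_of_notMem (by simp [hz, hr'.le])]
      · have hz' : 0 < ‖z‖ := norm_pos_iff.2 hz
        filter_upwards [mem_nhdsWithin_of_mem_nhds (Iio_mem_nhds hz')] with r hr
        have hr' : r < ‖z‖ := hr
        rw [indicator_of_mem (by exact hz'), indicator_of_mem (by exact hr')]
  · exact tendsto_pow_atTop_nhds_zero_of_lt_one (by norm_num) (by norm_num)
  · intro n
    simp only [add_sub_cancel_left]
    have hms : MeasurableSet {z : EuclideanSpace ℝ (Fin d) | rs n < ‖z‖} :=
      measurableSet_lt measurable_const measurable_norm
    let D : ℝ → ℝ := fun r => r ^ (-(d:ℝ)) * (r ^ 2 - (rs n) ^ 2) ^ (-(α / 2))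
    have hDm : Measurable D := by simp only [D]; fun_prop
    let P : EuclideanSpace ℝ (Fin d) → ℝ := fun z =>
      (Ioo (rs n) (2 * rs n)).indicator (fun r => dkh α (rs n) r * D r) ‖z‖
    have hPm : Measurable P :=
      (((dkh_measurable α (rs n)).mul hDm).indicator measurableSet_Ioo).comp measurable_norm
    have hD0 : ∀ r, rs n < r → 0 ≤ D r := fun r hr => by
      have h2 : 0 < r := (hpos n).trans hr
      have h3 : 0 < r ^ 2 - (rs n) ^ 2 := by nlinarith [hpos n]
      simp only [D]; positivity
    have hP0 : ∀ z, 0 ≤ P z := fun z =>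
      indicator_nonneg (fun r hr => mul_nonneg (dkh_nonneg (hpos n) hr) (hD0 r hr.1)) _
    have hPtop : ∫⁻ z, ENNReal.ofReal (P z) = ⊤ := by
      by_contra hne
      refine dk_nonint d hd α (rs n) (hpos n) ⟨hPm.aestronglyMeasurable, ?_⟩
      rw [hasFiniteIntegral_iff_ofReal (Filter.Eventually.of_forall hP0)]
      exact lt_top_iff_ne_top.2 hne
    rw [← lintegral_indicator hms, eq_top_iff]
    have hδtop : (⊤ : ENNReal) = ∫⁻ z, (δ n : ENNReal) * ENNReal.ofReal (P z) := by
      rw [lintegral_const_mul _ hPm.ennreal_ofReal, hPtop, ENNReal.mul_top]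
      simpa using (hδ n).ne'
    rw [hδtop]
    refine lintegral_mono_ae ?_
    filter_upwards [hGfin] with z hz
    by_cases hzm : ‖z‖ ∈ Ioo (rs n) (2 * rs n)
    · rw [indicator_of_mem (by exact hzm.1), ENNReal.ofReal_mul ENNReal.toReal_nonneg,
        ENNReal.ofReal_toReal hz.ne]
      have h1 : P z = H n z * D ‖z‖ := by simp only [P, H, indicator_of_mem hzm]
      rw [h1, ENNReal.ofReal_mul (hH0 n z), ← mul_assoc]
      refine mul_le_mul_left ?_ _
      exact ENNReal.le_tsum (f := fun n => (δ n : ENNReal) * ENNReal.ofReal (H n z)) n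
    · have h1 : P z = 0 := by simp only [P, indicator_of_notMem hzm]
      simp [h1]
end
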